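/- arXiv:1105.5578 — 12 statements merged into one kernel-verified Lean document; each statement's English description precedes it below -/
import Mathlib

section
/- Let (Ω, P) be a probability space and let X, Y : Ω → ℝ be random variables such that Y ≥ 0 almost surely, 1 + Y ≥ 2X almost surely, and E[Y] = p² for some p ∈ [0,1]. Then for every τ ∈ (1/2, 1], P(X ≥ τ) ≤ p²/(2τ − 1). (This is Lemma 1(i) of the paper in abstract form: with X = Π̂_B(k) the CPSS selection proportion of variable k and Y = Π̃_B(k) the simultaneous selection proportion, one has 1 + Π̃_B(k) ≥ 2Π̂_B(k) pointwise and E[Π̃_B(k)] = p_{k,⌊n/2⌋}², so the probability that CPSS with threshold τ selects variable k is at most p_{k,⌊n/2⌋}²/(2τ−1).) -/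
open MeasureTheory

/-- Lemma 1(i) of Shah & Samworth (2013), abstract form: if `Y ≥ 0` a.s.,
`1 + Y ≥ 2X` a.s. and `E[Y] = p²` with `p ∈ [0,1]`, then for `τ ∈ (1/2, 1]`,
`P(X ≥ τ) ≤ p² / (2τ - 1)`. -/
theorem cpss_selection_prob_bound {Ω : Type*} [MeasurableSpace Ω]
    (P : Measure Ω) [IsProbabilityMeasure P]
    (X Y : Ω → ℝ) (hXmeas : Measurable X) (hYint : Integrable Y P)
    (hYnn : ∀ᵐ ω ∂P, 0 ≤ Y ω)
    (hXY : ∀ᵐ ω ∂P, 2 * X ω ≤ 1 + Y ω)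
    (p : ℝ) (hp : p ∈ Set.Icc (0 : ℝ) 1)
    (hEY : ∫ ω, Y ω ∂P = p ^ 2)
    (τ : ℝ) (hτ : τ ∈ Set.Ioc (1 / 2 : ℝ) 1) :
    (P {ω | τ ≤ X ω}).toReal ≤ p ^ 2 / (2 * τ - 1) := by
  have hτ_pos : 0 < 2 * τ - 1 := by linarith [hτ.1]
  have hsubset : {ω | τ ≤ X ω} ≤ᵐ[P] {ω | 2 * τ - 1 ≤ Y ω} := by
    filter_upwards [hXY] with ω hω (hX : τ ≤ X ω)
    change 2 * τ - 1 ≤ Y ω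
    linarith
  have hmono : P.real {ω | τ ≤ X ω} ≤ P.real {ω | 2 * τ - 1 ≤ Y ω} :=
    ENNReal.toReal_mono (measure_ne_top P _) (measure_mono_ae hsubset)
  have hmarkov := mul_meas_ge_le_integral_of_nonneg hYnn hYint (2 * τ - 1)
  rw [hEY] at hmarkov
  exact hmono.trans ((le_div_iff₀' hτ_pos).2 hmarkov)
end

section
/- Let (Ω, P) be a probability space and let X, Y : Ω → ℝ be random variables such that Y ≥ 0 almost surely, 1 + Y ≥ 2(1 − X) almost surely, and E[Y] = (1 − p)² for some p ∈ [0,1]. Then for every τ ∈ [0, 1/2), P(X < τ) ≤ (1 − p)²/(1 − 2τ). (This is Lemma 1(ii) of the paper in abstract form: the probability that CPSS with threshold τ fails to select a variable with selection probability p = p_{k,⌊n/2⌋} is at most (1 − p_{k,⌊n/2⌋})²/(1 − 2τ).) -/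
open MeasureTheory

/-- Lemma 1(ii) of Shah & Samworth (2013), abstract form: if `Y ≥ 0` a.s.,
`1 + Y ≥ 2(1 - X)` a.s. and `E[Y] = (1-p)²` with `p ∈ [0,1]`, then for
`τ ∈ [0, 1/2)`, `P(X < τ) ≤ (1-p)² / (1 - 2τ)`. -/
theorem cpss_missed_prob_bound {Ω : Type*} [MeasurableSpace Ω]
    (P : Measure Ω) [IsProbabilityMeasure P]
    (X Y : Ω → ℝ) (hXmeas : Measurable X) (hYint : Integrable Y P)
    (hYnn : ∀ᵐ ω ∂P, 0 ≤ Y ω)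
    (hXY : ∀ᵐ ω ∂P, 2 * (1 - X ω) ≤ 1 + Y ω)
    (p : ℝ) (hp : p ∈ Set.Icc (0 : ℝ) 1)
    (hEY : ∫ ω, Y ω ∂P = (1 - p) ^ 2)
    (τ : ℝ) (hτ : τ ∈ Set.Ico (0 : ℝ) (1 / 2)) :
    (P {ω | X ω < τ}).toReal ≤ (1 - p) ^ 2 / (1 - 2 * τ) := by
  have hpos : 0 < 1 - 2 * τ := by linarith [hτ.2]
  have markov := mul_meas_ge_le_integral_of_nonneg hYnn hYint (1 - 2 * τ)
  have hsub : P.real {ω | X ω < τ} ≤ P.real {ω | 1 - 2 * τ ≤ Y ω} := by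
    refine ENNReal.toReal_mono (measure_ne_top _ _) (measure_mono_ae ?_)
    filter_upwards [hXY] with ω hω (hX : X ω < τ)
    change 1 - 2 * τ ≤ Y ω
    linarith
  rw [hEY] at markov
  rw [le_div_iff₀' hpos]
  exact (mul_le_mul_of_nonneg_left hsub hpos.le).trans markov
end

section
/- Let (Ω, P) be a probability space, let p ≥ 1 be an integer, and for each k ∈ {1,...,p} let p_k ∈ [0,1] and let X_k, Y_k : Ω → ℝ be random variables with Y_k ≥ 0 almost surely, 1 + Y_k ≥ 2X_k almost surely, and E[Y_k] = p_k². Fix θ ∈ [0,1] and let L_θ = {k ∈ {1,...,p} : p_k ≤ θ}. Then for every τ ∈ (1/2, 1], ∑_{k ∈ L_θ} P(X_k ≥ τ) ≤ (θ/(2τ − 1)) ∑_{k ∈ L_θ} p_k. (This is Theorem 1(i) of the paper: the expected number of low selection probability variables chosen by CPSS, E|Ŝ^{CPSS}_{n,τ} ∩ L_θ| = ∑_{k∈L_θ} P(Π̂_B(k) ≥ τ), is at most θ/(2τ−1) times E|Ŝ_{⌊n/2⌋} ∩ L_θ| = ∑_{k∈L_θ} p_k.) -/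
open MeasureTheory

/-- If `2X ≤ 1 + Y` with `Y ≥ 0`, then Markov's inequality for `Y` bounds the upper tail of `X`. -/
theorem mul_measureReal_le_integral_of_two_mul_le_one_add {Ω : Type*} [MeasurableSpace Ω]
    {P : Measure Ω} [IsFiniteMeasure P] {X Y : Ω → ℝ} (hY : Integrable Y P)
    (hY_nonneg : 0 ≤ᵐ[P] Y) (hXY : ∀ᵐ ω ∂P, 2 * X ω ≤ 1 + Y ω) (τ : ℝ) (hτ : 1 / 2 ≤ τ) :
    (2 * τ - 1) * P.real {ω | τ ≤ X ω} ≤ ∫ ω, Y ω ∂P := by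
  have h_subset : P.real {ω | τ ≤ X ω} ≤ P.real {ω | 2 * τ - 1 ≤ Y ω} := by
    refine ENNReal.toReal_mono (measure_ne_top _ _) (measure_mono_ae ?_)
    filter_upwards [hXY] with ω hω (hX : τ ≤ X ω)
    change 2 * τ - 1 ≤ Y ω
    linarith
  exact (mul_le_mul_of_nonneg_left h_subset (by linarith)).trans
    (mul_meas_ge_le_integral_of_nonneg hY_nonneg hY _)

/-- Theorem 1(i) of Shah & Samworth (2013), abstract form: the expected number of
low selection probability variables chosen by CPSS, `∑_{k ∈ L_θ} P(X_k ≥ τ)`, is at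
most `θ/(2τ-1)` times `∑_{k ∈ L_θ} p_k`. -/
theorem cpss_low_selection_bound {Ω : Type*} [MeasurableSpace Ω]
    (P : Measure Ω) [IsProbabilityMeasure P]
    (p : ℕ) (hp : 1 ≤ p) (pk : Fin p → ℝ) (X Y : Fin p → Ω → ℝ)
    (hXmeas : ∀ k, Measurable (X k)) (hYint : ∀ k, Integrable (Y k) P)
    (hYnn : ∀ k, ∀ᵐ ω ∂P, 0 ≤ Y k ω)
    (hXY : ∀ k, ∀ᵐ ω ∂P, 2 * X k ω ≤ 1 + Y k ω)
    (hpk : ∀ k, pk k ∈ Set.Icc (0 : ℝ) 1)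
    (hEY : ∀ k, ∫ ω, Y k ω ∂P = pk k ^ 2)
    (θ : ℝ) (hθ : θ ∈ Set.Icc (0 : ℝ) 1)
    (τ : ℝ) (hτ : τ ∈ Set.Ioc (1 / 2 : ℝ) 1) :
    ∑ k ∈ Finset.univ.filter (fun k => pk k ≤ θ), (P {ω | τ ≤ X k ω}).toReal
      ≤ θ / (2 * τ - 1) * ∑ k ∈ Finset.univ.filter (fun k => pk k ≤ θ), pk k := by
  have hτ_pos : 0 < 2 * τ - 1 := by linarith [hτ.1]
  rw [Finset.mul_sum]
  refine Finset.sum_le_sum fun k hk => ?_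
  have hkθ : pk k ≤ θ := (Finset.mem_filter.mp hk).2
  have h_markov := mul_measureReal_le_integral_of_two_mul_le_one_add (hYint k) (hYnn k) (hXY k)
    τ hτ.1.le
  rw [hEY k, Measure.real] at h_markov
  rw [div_mul_eq_mul_div, le_div_iff₀ hτ_pos]
  nlinarith [mul_le_mul_of_nonneg_right hkθ (hpk k).1]
end

section
/- Let (Ω, P) be a probability space, let p ≥ 1 be an integer, and for each k ∈ {1,...,p} let p_k ∈ [0,1] and let X_k, Y_k : Ω → ℝ be random variables with Y_k ≥ 0 almost surely, 1 + Y_k ≥ 2(1 − X_k) almost surely, and E[Y_k] = (1 − p_k)². Fix θ ∈ [0,1] and let H_θ = {k ∈ {1,...,p} : p_k > θ}. Then for every τ ∈ [0, 1/2), ∑_{k ∈ H_θ} P(X_k < τ) ≤ ((1 − θ)/(1 − 2τ)) ∑_{k ∈ H_θ} (1 − p_k). (This is Theorem 1(ii) of the paper: the expected number of high selection probability variables excluded by CPSS is at most (1−θ)/(1−2τ) times the expected number of high selection probability variables excluded by the base procedure.) -/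
open MeasureTheory

/-- If `2 * (1 - X) ≤ 1 + Y` with `Y ≥ 0`, Markov's inequality for `Y` controls the lower tail
of `X` below `1 / 2`. -/
theorem measureReal_lt_le_integral_div {Ω : Type*} [MeasurableSpace Ω] {P : Measure Ω}
    [IsFiniteMeasure P] {X Y : Ω → ℝ} (hYint : Integrable Y P) (hYnn : 0 ≤ᵐ[P] Y)
    (hXY : ∀ᵐ ω ∂P, 2 * (1 - X ω) ≤ 1 + Y ω) {τ : ℝ} (hτ : τ < 1 / 2) :
    P.real {ω | X ω < τ} ≤ (∫ ω, Y ω ∂P) / (1 - 2 * τ) := by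
  have hsub : {ω | X ω < τ} ≤ᵐ[P] {ω | 1 - 2 * τ ≤ Y ω} := by
    filter_upwards [hXY] with ω hω
    change X ω < τ → 1 - 2 * τ ≤ Y ω
    intro h
    linarith
  have hmono : P.real {ω | X ω < τ} ≤ P.real {ω | 1 - 2 * τ ≤ Y ω} :=
    ENNReal.toReal_mono (measure_ne_top P _) (measure_mono_ae hsub)
  have hpos : 0 < 1 - 2 * τ := by linarith
  rw [le_div_iff₀' hpos]
  exact (mul_le_mul_of_nonneg_left hmono hpos.le).trans
    (mul_meas_ge_le_integral_of_nonneg hYnn hYint _)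

/-- Theorem 1(ii) of Shah & Samworth (2013), abstract form: the expected number of
high selection probability variables excluded by CPSS, `∑_{k ∈ H_θ} P(X_k < τ)`, is
at most `(1-θ)/(1-2τ)` times `∑_{k ∈ H_θ} (1 - p_k)`. -/
theorem cpss_high_exclusion_bound {Ω : Type*} [MeasurableSpace Ω]
    (P : Measure Ω) [IsProbabilityMeasure P]
    (p : ℕ) (hp : 1 ≤ p) (pk : Fin p → ℝ) (X Y : Fin p → Ω → ℝ)
    (hXmeas : ∀ k, Measurable (X k)) (hYint : ∀ k, Integrable (Y k) P)
    (hYnn : ∀ k, ∀ᵐ ω ∂P, 0 ≤ Y k ω)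
    (hXY : ∀ k, ∀ᵐ ω ∂P, 2 * (1 - X k ω) ≤ 1 + Y k ω)
    (hpk : ∀ k, pk k ∈ Set.Icc (0 : ℝ) 1)
    (hEY : ∀ k, ∫ ω, Y k ω ∂P = (1 - pk k) ^ 2)
    (θ : ℝ) (hθ : θ ∈ Set.Icc (0 : ℝ) 1)
    (τ : ℝ) (hτ : τ ∈ Set.Ico (0 : ℝ) (1 / 2)) :
    ∑ k ∈ Finset.univ.filter (fun k => θ < pk k), (P {ω | X k ω < τ}).toReal
      ≤ (1 - θ) / (1 - 2 * τ) * ∑ k ∈ Finset.univ.filter (fun k => θ < pk k), (1 - pk k) := by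
  rw [Finset.mul_sum]
  refine Finset.sum_le_sum fun k hk => ?_
  have hθk : θ < pk k := (Finset.mem_filter.mp hk).2
  have hpos : 0 < 1 - 2 * τ := by linarith [hτ.2]
  calc (P {ω | X k ω < τ}).toReal ≤ (∫ ω, Y k ω ∂P) / (1 - 2 * τ) :=
        measureReal_lt_le_integral_div (hYint k) (hYnn k) (hXY k) hτ.2
    _ = (1 - pk k) * (1 - pk k) / (1 - 2 * τ) := by rw [hEY k, sq]
    _ ≤ (1 - θ) * (1 - pk k) / (1 - 2 * τ) := by
        have h1 : 0 ≤ 1 - pk k := sub_nonneg.mpr (hpk k).2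
        gcongr
    _ = (1 - θ) / (1 - 2 * τ) * (1 - pk k) := by ring
end

section
/- Let B ≥ 1 be an integer, let (Ω, P) be a probability space, let p ≥ 1, and for each k ∈ {1,...,p} let p_k ∈ [0,1] and let X_k, Y_k : Ω → ℝ be random variables such that Y_k takes values in {0, 1/B, 2/B, ..., 1} with unimodal probability mass function, 1 + Y_k ≥ 2X_k almost surely, and E[Y_k] = p_k². Fix θ ∈ [0, 1/√3] and let L_θ = {k : p_k ≤ θ}. Suppose τ = 1/2 + j/(2B) for some integer j ≥ 2 (so τ ∈ {1/2 + 1/B, 1/2 + 3/(2B), 1/2 + 2/B, ..., 1}). Define C(τ, B) = 1/(2(2τ − 1 − 1/(2B))) if min(1/2 + θ², 1/2 + 1/(2B) + (3/4)θ²) < τ ≤ 3/4, and C(τ, B) = 4(1 − τ + 1/(2B))/(1 + 1/B) if 3/4 < τ ≤ 1. Then, for τ in either of these ranges, ∑_{k ∈ L_θ} P(X_k ≥ τ) ≤ C(τ, B) · θ · ∑_{k ∈ L_θ} p_k. (This is Theorem 2 of the paper: under unimodality of the distributions of Π̃_B(k) for k ∈ L_θ, E|Ŝ^{CPSS}_{n,τ}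 ∩ L_θ| ≤ C(τ,B) θ E|Ŝ_{⌊n/2⌋} ∩ L_θ|.) -/
open MeasureTheory

/-- A probability mass function `f` on the lattice `{0, 1/B, ..., 1}` (indexed by
`{0, 1, ..., B}`) is unimodal if it increases up to some mode `m ≤ B` and decreases
afterwards. -/
def UnimodalOn (B : ℕ) (f : ℕ → ℝ) : Prop :=
  ∃ m ≤ B, (∀ i j, i ≤ j → j ≤ m → f i ≤ f j) ∧ (∀ i j, m ≤ i → i ≤ j → j ≤ B → f j ≤ f i)

open Finset in
/-- A unimodal sequence is a nonnegative combination of indicators of intervals containing the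
mode, so its pairing with `h` is nonnegative as soon as `h` has nonnegative sum over each such
interval. -/
theorem sum_mul_nonneg_of_unimodal (m : ℕ) (h : ℕ → ℝ) (n : ℕ) :
    ∀ (a b : ℕ) (f : ℕ → ℝ), b = a + n → a ≤ m → m ≤ b →
      (∀ a' b', a ≤ a' → a' ≤ m → m ≤ b' → b' ≤ b → 0 ≤ ∑ i ∈ Icc a' b', h i) →
      (∀ i ∈ Icc a b, 0 ≤ f i) →
      (∀ i j, a ≤ i → i ≤ j → j ≤ m → f i ≤ f j) →
      (∀ i j, m ≤ i → i ≤ j → j ≤ b → f j ≤ f i) →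
      0 ≤ ∑ i ∈ Icc a b, f i * h i := by
  induction n with
  | zero =>
    intro a b f hb ham hmb hh hf _ _
    obtain rfl : b = a := by omega
    have h1 := hh b b le_rfl ham hmb le_rfl
    have h2 := hf b (by simp)
    simp only [Icc_self, sum_singleton] at h1 ⊢
    exact mul_nonneg h2 h1
  | succ n ih =>
    intro a b f hb ham hmb hh hf hup hdown
    have htot := hh a b le_rfl ham hmb le_rfl
    have shift : ∀ c : ℝ, ∑ i ∈ Icc a b, f i * h i
        = c * ∑ i ∈ Icc a b, h i + ∑ i ∈ Icc a b, (f i - c) * h i := by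
      intro c
      rw [mul_sum, ← sum_add_distrib]
      exact sum_congr rfl fun i _ => by ring
    by_cases hcase : a < m ∧ f a ≤ f b
    · obtain ⟨ham', hab⟩ := hcase
      have hmin : ∀ i, a ≤ i → i ≤ b → f a ≤ f i := by
        intro i hi hib
        rcases le_total i m with him | him
        · exact hup a i le_rfl hi him
        · exact hab.trans (hdown i b him hib le_rfl)
      have key := ih (a + 1) b (fun i => f i - f a) (by omega) ham' hmb
        (fun a' b' h1 h2 h3 h4 => hh a' b' (by omega) h2 h3 h4)
        (fun i hi => by
          rw [mem_Icc] at hi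
          exact sub_nonneg.2 (hmin i (by omega) hi.2))
        (fun i j h1 h2 h3 => sub_le_sub_right (hup i j (by omega) h2 h3) _)
        (fun i j h1 h2 h3 => sub_le_sub_right (hdown i j h1 h2 h3) _)
      have hfa := hf a (mem_Icc.2 ⟨le_rfl, by omega⟩)
      have hsplit : ∑ i ∈ Icc a b, (f i - f a) * h i
          = ∑ i ∈ Icc (a + 1) b, (f i - f a) * h i := by
        rw [← insert_Icc_add_one_left_eq_Icc (show a ≤ b by omega), sum_insert (by simp)]
        simp
      rw [shift (f a), hsplit]
      exact add_nonneg (mul_nonneg hfa htot) key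
    · have hmb' : m < b := by
        by_contra hcon
        obtain rfl : m = b := by omega
        exact hcase ⟨by omega, hup a m le_rfl ham le_rfl⟩
      have hba : f b ≤ f a := by
        rcases ham.lt_or_eq with h1 | rfl
        · by_contra hcon
          exact hcase ⟨h1, (not_le.1 hcon).le⟩
        · exact hdown a b le_rfl hmb le_rfl
      have hmin : ∀ i, a ≤ i → i ≤ b → f b ≤ f i := by
        intro i hi hib
        rcases le_total i m with him | him
        · exact hba.trans (hup a i le_rfl hi him)
        · exact hdown i b him hib le_rfl
      obtain ⟨b, rfl⟩ : ∃ d, b = d + 1 := ⟨b - 1, by omega⟩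
      have key := ih a b (fun i => f i - f (b + 1)) (by omega) ham (by omega)
        (fun a' b' h1 h2 h3 h4 => hh a' b' h1 h2 h3 (by omega))
        (fun i hi => by
          rw [mem_Icc] at hi
          exact sub_nonneg.2 (hmin i hi.1 (by omega)))
        (fun i j h1 h2 h3 => sub_le_sub_right (hup i j h1 h2 h3) _)
        (fun i j h1 h2 h3 => sub_le_sub_right (hdown i j h1 h2 (by omega)) _)
      have hfb := hf (b + 1) (mem_Icc.2 ⟨by omega, le_rfl⟩)
      have hsplit : ∑ i ∈ Icc a (b + 1), (f i - f (b + 1)) * h i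
          = ∑ i ∈ Icc a b, (f i - f (b + 1)) * h i := by
        rw [sum_Icc_succ_top (by omega)]
        simp
      rw [shift (f (b + 1)), hsplit]
      exact add_nonneg (mul_nonneg hfb htot) key

open Finset in
theorem two_mul_sum_Icc_cast (a b : ℕ) (hab : a ≤ b) :
    2 * ∑ i ∈ Icc a b, (i : ℝ) = ((b : ℝ) - a + 1) * (a + b) := by
  induction b, hab using Nat.le_induction with
  | base => simp; ring
  | succ b hab ih =>
    rw [sum_Icc_succ_top (by omega), mul_add, ih]
    push_cast
    ring

open Finset in
theorem sum_Icc_ite_le (a b j : ℕ) (haj : a ≤ j) :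
    ∑ i ∈ Icc a b, (if j ≤ i then (1 : ℝ) else 0) = ((b + 1 - j : ℕ) : ℝ) := by
  rw [sum_boole]
  congr 1
  rw [← Nat.card_Icc]
  congr 1
  ext i
  simp only [mem_filter, mem_Icc]
  omega

open Finset in
theorem sum_Icc_affine_sub_ite (a b j : ℕ) (hab : a ≤ b) (haj : a ≤ j) (s u w : ℝ) :
    ∑ i ∈ Icc a b, (s * (2 * i - u) - w * (if j ≤ i then (1 : ℝ) else 0))
      = s * (((b : ℝ) - a + 1) * (a + b - u)) - w * ((b + 1 - j : ℕ) : ℝ) := by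
  rw [sum_sub_distrib, ← mul_sum, ← mul_sum, sum_sub_distrib, ← mul_sum,
    two_mul_sum_Icc_cast a b hab, sum_Icc_ite_le a b j haj, sum_const, Nat.card_Icc, nsmul_eq_mul,
    Nat.cast_sub (show a ≤ b + 1 by omega)]
  push_cast
  ring

open Finset in
/-- If an affine function minus a multiple of the indicator of `[j, ∞)` has nonnegative sums over
intervals containing the mode, this transfers to the tail and the mean of the distribution. -/
theorem mul_tail_le_of_unimodal (B m j : ℕ) (f : ℕ → ℝ) (hmB : m ≤ B)
    (hf : ∀ i, 0 ≤ f i) (hup : ∀ i j, i ≤ j → j ≤ m → f i ≤ f j)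
    (hdown : ∀ i j, m ≤ i → i ≤ j → j ≤ B → f j ≤ f i) (hsum : ∑ i ∈ Icc 0 B, f i = 1)
    (s u w : ℝ)
    (hh : ∀ a b, a ≤ m → m ≤ b → b ≤ B →
      0 ≤ ∑ i ∈ Icc a b, (s * (2 * (i : ℝ) - u) - w * (if j ≤ i then (1 : ℝ) else 0))) :
    w * ∑ i ∈ Icc 0 B, (if j ≤ i then (1 : ℝ) else 0) * f i
      ≤ s * (2 * ∑ i ∈ Icc 0 B, (i : ℝ) * f i - u) := by
  have h := sum_mul_nonneg_of_unimodal m _ B 0 B f (by omega) (Nat.zero_le _) hmB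
    (fun a b _ h1 h2 h3 => hh a b h1 h2 h3) (fun i _ => hf i) (fun i j _ => hup i j) hdown
  have e : ∑ i ∈ Icc 0 B, f i * (s * (2 * (i : ℝ) - u) - w * (if j ≤ i then (1 : ℝ) else 0))
      = s * (2 * ∑ i ∈ Icc 0 B, (i : ℝ) * f i - u * ∑ i ∈ Icc 0 B, f i)
        - w * ∑ i ∈ Icc 0 B, (if j ≤ i then (1 : ℝ) else 0) * f i := by
    simp only [mul_sum, ← sum_sub_distrib]
    exact sum_congr rfl fun i _ => by ring
  rw [e, hsum, mul_one] at h
  linarith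

open Finset in
/-- Markov's inequality for unimodal distributions on `{0, ..., B}`: if the mean is at most `M`,
then the tail at `j` is at most `2 * c` times the mean. -/
theorem tail_le_of_unimodal (B j : ℕ) (f : ℕ → ℝ) (hj : 2 ≤ j) (hf : ∀ i, 0 ≤ f i)
    (huni : UnimodalOn B f) (hsum : ∑ i ∈ Icc 0 B, f i = 1) (c M : ℝ) (hc : 0 ≤ c)
    (hM : 0 ≤ M) (hmean : ∑ i ∈ Icc 0 B, (i : ℝ) * f i ≤ M)
    (h1 : ∀ b : ℕ, j ≤ b → b ≤ B → (b : ℝ) - j + 1 ≤ c * (b * (b + 1)))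
    (h2 : 2 * M - j + 1 ≤ 2 * c * M * (j + 1)) :
    ∑ i ∈ Icc 0 B, (if j ≤ i then (1 : ℝ) else 0) * f i
      ≤ 2 * c * ∑ i ∈ Icc 0 B, (i : ℝ) * f i := by
  obtain ⟨m, hmB, hup, hdown⟩ := huni
  have key := mul_tail_le_of_unimodal B m j f hmB hf hup hdown hsum
  set T := ∑ i ∈ Icc 0 B, (if j ≤ i then (1 : ℝ) else 0) * f i
  have hμ0 : 0 ≤ ∑ i ∈ Icc 0 B, (i : ℝ) * f i :=
    sum_nonneg fun i _ => mul_nonneg (Nat.cast_nonneg _) (hf i)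
  set μ := ∑ i ∈ Icc 0 B, (i : ℝ) * f i
  have hjR : (2 : ℝ) ≤ j := by exact_mod_cast hj
  rcases le_or_gt j m with hjm | hmj
  · have hT := key 1 (j - 1) (j + 1) (by
      intro a b ham hmb hbB
      rcases le_or_gt a j with haj | haj
      · rw [sum_Icc_affine_sub_ite a b j (by omega) haj, Nat.cast_sub (by omega)]
        have e1 : (a : ℝ) ≤ j := by exact_mod_cast haj
        have e2 : (j : ℝ) ≤ b := by exact_mod_cast hjm.trans hmb
        have e3 : (0 : ℝ) ≤ a := Nat.cast_nonneg _
        push_cast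
        nlinarith [mul_nonneg e3 (sub_nonneg.2 e1), mul_nonneg (sub_nonneg.2 e2) (sub_nonneg.2 e2)]
      · refine sum_nonneg fun i hi => ?_
        rw [mem_Icc] at hi
        have e1 : (j : ℝ) + 1 ≤ i := by exact_mod_cast (show j + 1 ≤ i by omega)
        rw [if_pos (by omega)]
        linarith)
    rcases le_or_gt (c * (j + 1)) 1 with hcj | hcj
    · have : (j + 1) * T ≤ (j + 1) * (2 * c * μ) := by
        nlinarith [mul_nonneg (sub_nonneg.2 hcj) (sub_nonneg.2 hmean)]
      exact le_of_mul_le_mul_left this (by linarith)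
    · have : (j + 1) * T ≤ (j + 1) * (2 * c * μ) := by
        nlinarith [mul_nonneg (sub_nonneg.2 hcj.le) hμ0]
      exact le_of_mul_le_mul_left this (by linarith)
  · have hmjR : (m : ℝ) ≤ j - 1 := by
      have : (m : ℝ) + 1 ≤ j := by exact_mod_cast hmj
      linarith
    have hm0 : (0 : ℝ) ≤ m := Nat.cast_nonneg _
    rcases le_or_gt (2 * M) m with hMm | hMm
    · have hT := key 1 m 1 (by
        intro a b ham hmb hbB
        rw [sum_Icc_affine_sub_ite a b j (by omega) (by omega)]
        have e1 : (a : ℝ) ≤ b := by exact_mod_cast ham.trans hmb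
        have e2 : (m : ℝ) ≤ b := by exact_mod_cast hmb
        have e3 : (0 : ℝ) ≤ a := Nat.cast_nonneg _
        have e4 : ((b + 1 - j : ℕ) : ℝ) ≤ a + b - m := by
          have : b + 1 - j + m ≤ a + b := by omega
          have : ((b + 1 - j : ℕ) : ℝ) + m ≤ a + b := by exact_mod_cast this
          linarith
        nlinarith [mul_nonneg (sub_nonneg.2 e1) (show (0 : ℝ) ≤ a + b - m by linarith)])
      have : 0 ≤ 2 * c * μ := by positivity
      linarith
    · have hcM : 0 ≤ 2 * c * M := by positivity
      have hT := key (2 * c * M) m (2 * M - m) (by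
        intro a b ham hmb hbB
        rw [sum_Icc_affine_sub_ite a b j (by omega) (by omega)]
        have e1 : (a : ℝ) ≤ m := by exact_mod_cast ham
        have e2 : (m : ℝ) ≤ b := by exact_mod_cast hmb
        have e3 : (0 : ℝ) ≤ a := Nat.cast_nonneg _
        rcases lt_or_ge b j with hbj | hjb
        · rw [Nat.sub_eq_zero_of_le (by omega), Nat.cast_zero, mul_zero, sub_zero]
          exact mul_nonneg hcM (mul_nonneg (by linarith) (by linarith))
        rw [Nat.cast_sub (by omega)]
        push_cast
        have e4 : (j : ℝ) ≤ b := by exact_mod_cast hjb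
        have hk : (0 : ℝ) ≤ b - j + 1 := by linarith
        have at_zero : 2 * M * (b - j + 1) ≤ 2 * c * M * (b * (b + 1)) := by
          nlinarith [mul_le_mul_of_nonneg_left (h1 b hjb hbB) hM]
        have at_pred : (2 * M - j + 1) * (b - j + 1) ≤ 2 * c * M * ((b - j + 1) * (b + 1)) := by
          have : 2 * M - j + 1 ≤ 2 * c * M * (b + 1) :=
            h2.trans (mul_le_mul_of_nonneg_left (by linarith) hcM)
          nlinarith [mul_le_mul_of_nonneg_right this hk]
        have interp : ((j : ℝ) - 1) * ((2 * M - m) * (b - j + 1))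
            ≤ (j - 1) * (2 * c * M * ((b - m) * (b + 1))) := by
          have i1 := mul_le_mul_of_nonneg_left at_zero (sub_nonneg.2 hmjR)
          have i2 := mul_le_mul_of_nonneg_left at_pred hm0
          linarith
        have hzero := le_of_mul_le_mul_left interp (by linarith)
        have hmono := mul_le_mul_of_nonneg_left
          (show ((b : ℝ) - m) * (b + 1) ≤ (b - a + 1) * (a + b - m) by
            nlinarith [mul_nonneg e3 (show (0 : ℝ) ≤ m + 1 - a by linarith)]) hcM
        linarith)
      have : (2 * M - m) * T ≤ (2 * M - m) * (2 * c * μ) := by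
        nlinarith [mul_nonneg (mul_nonneg hc hm0) (sub_nonneg.2 hmean)]
      exact le_of_mul_le_mul_left this (by linarith)

open Finset in
theorem integral_comp_eq_sum_of_lattice {Ω : Type*} [MeasurableSpace Ω] (P : Measure Ω)
    [IsProbabilityMeasure P] (B : ℕ) (hB : 1 ≤ B) (Y : Ω → ℝ) (hY : Measurable Y)
    (hlat : ∀ ω, ∃ i ≤ B, Y ω = (i : ℝ) / B) (g : ℝ → ℝ) :
    ∫ ω, g (Y ω) ∂P = ∑ i ∈ Icc 0 B, g ((i : ℝ) / B) * (P {ω | Y ω = (i : ℝ) / B}).toReal := by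
  have hBR : (B : ℝ) ≠ 0 := by
    have : B ≠ 0 := by omega
    exact_mod_cast this
  have hms : ∀ i : ℕ, MeasurableSet {ω | Y ω = (i : ℝ) / B} := fun i =>
    hY (measurableSet_singleton _)
  have hg : ∀ ω, g (Y ω) = ∑ i ∈ Icc 0 B,
      {ω | Y ω = (i : ℝ) / B}.indicator (fun _ => g ((i : ℝ) / B)) ω := by
    intro ω
    obtain ⟨i, hi, hYi⟩ := hlat ω
    rw [sum_eq_single i]
    · rw [Set.indicator_of_mem (by exact hYi), hYi]
    · intro l _ hl
      refine Set.indicator_of_notMem (fun hmem => hl ?_) _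
      have : (l : ℝ) / B = (i : ℝ) / B := hmem.symm.trans hYi
      exact_mod_cast (div_left_inj' hBR).1 this
    · intro h
      simp [hi] at h
  simp_rw [hg]
  rw [integral_finsetSum _ fun i _ => (integrable_const _).indicator (hms i)]
  refine sum_congr rfl fun i _ => ?_
  rw [integral_indicator_const _ (hms i), smul_eq_mul, mul_comm]
  rfl

open Finset in
/-- The bound for a single variable: `2 * X ≤ 1 + Y` almost surely, with `Y` unimodal on the
lattice. -/
theorem prob_ge_le_of_unimodal_lattice {Ω : Type*} [MeasurableSpace Ω] (P : Measure Ω)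
    [IsProbabilityMeasure P] (B : ℕ) (hB : 1 ≤ B) (X Y : Ω → ℝ) (hY : Measurable Y)
    (hlat : ∀ ω, ∃ i ≤ B, Y ω = (i : ℝ) / B)
    (huni : UnimodalOn B (fun i => (P {ω | Y ω = (i : ℝ) / B}).toReal))
    (hXY : ∀ᵐ ω ∂P, 2 * X ω ≤ 1 + Y ω) (τ : ℝ) (j : ℕ) (hj : 2 ≤ j)
    (hτ : τ = 1 / 2 + (j : ℝ) / (2 * B)) (c M : ℝ) (hc : 0 ≤ c) (hM : 0 ≤ M)
    (hmean : B * ∫ ω, Y ω ∂P ≤ M)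
    (h1 : ∀ b : ℕ, j ≤ b → b ≤ B → (b : ℝ) - j + 1 ≤ c * (b * (b + 1)))
    (h2 : 2 * M - j + 1 ≤ 2 * c * M * (j + 1)) :
    (P {ω | τ ≤ X ω}).toReal ≤ 2 * c * (B * ∫ ω, Y ω ∂P) := by
  have hBR : (0 : ℝ) < B := by exact_mod_cast hB
  have hI := integral_comp_eq_sum_of_lattice P B hB Y hY hlat
  have hsum := hI fun _ => 1
  simp only [integral_const, probReal_univ, smul_eq_mul, one_mul] at hsum
  have hEY : B * ∫ ω, Y ω ∂P
      = ∑ i ∈ Icc 0 B, (i : ℝ) * (P {ω | Y ω = (i : ℝ) / B}).toReal := by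
    rw [hI fun y => y, mul_sum]
    refine sum_congr rfl fun i _ => ?_
    field_simp
  have htail : (P {ω | (j : ℝ) / B ≤ Y ω}).toReal = ∑ i ∈ Icc 0 B,
      (if j ≤ i then (1 : ℝ) else 0) * (P {ω | Y ω = (i : ℝ) / B}).toReal := by
    have hms : MeasurableSet {ω | (j : ℝ) / B ≤ Y ω} := measurableSet_le measurable_const hY
    have h := hI ((Set.Ici ((j : ℝ) / B)).indicator fun _ => 1)
    have e : ∫ ω, (Set.Ici ((j : ℝ) / B)).indicator (fun _ => (1 : ℝ)) (Y ω) ∂P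
        = (P {ω | (j : ℝ) / B ≤ Y ω}).toReal := by
      have : (fun ω => (Set.Ici ((j : ℝ) / B)).indicator (fun _ => (1 : ℝ)) (Y ω))
          = {ω | (j : ℝ) / B ≤ Y ω}.indicator fun _ => 1 := rfl
      rw [this, integral_indicator_const _ hms, smul_eq_mul, mul_one]
      rfl
    rw [← e, h]
    refine sum_congr rfl fun i _ => ?_
    congr 1
    simp only [Set.indicator_apply, Set.mem_Ici, div_le_div_iff_of_pos_right hBR, Nat.cast_le]
  have hle : (P {ω | τ ≤ X ω}).toReal ≤ (P {ω | (j : ℝ) / B ≤ Y ω}).toReal := by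
    refine ENNReal.toReal_mono (measure_ne_top _ _) (measure_mono_ae ?_)
    filter_upwards [hXY] with ω hω hX
    change τ ≤ X ω at hX
    change (j : ℝ) / B ≤ Y ω
    have : (j : ℝ) / B = 2 * τ - 1 := by
      rw [hτ]
      field_simp
      ring
    linarith
  refine hle.trans ?_
  rw [htail]
  rw [hEY] at hmean ⊢
  exact tail_le_of_unimodal B j _ hj (fun i => ENNReal.toReal_nonneg) huni hsum.symm c M hc hM
    hmean h1 h2

/-- Theorem 2 of Shah & Samworth (2013): under unimodality of the distributions of
the simultaneous selection proportions `Y_k` (supported on `{0, 1/B, ..., 1}`), with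
`θ ≤ 1/√3` and `τ = 1/2 + j/(2B)` for an integer `j ≥ 2`,
`E|Ŝ^CPSS ∩ L_θ| ≤ C(τ,B) θ E|Ŝ ∩ L_θ|`, with `C(τ,B)` as in the paper. -/
theorem cpss_unimodal_bound {Ω : Type*} [MeasurableSpace Ω]
    (P : Measure Ω) [IsProbabilityMeasure P]
    (B : ℕ) (hB : 1 ≤ B) (p : ℕ) (hp : 1 ≤ p)
    (θ : ℝ) (hθ : θ ∈ Set.Icc (0 : ℝ) (1 / Real.sqrt 3))
    (pk : Fin p → ℝ) (X Y : Fin p → Ω → ℝ)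
    (hXmeas : ∀ k, Measurable (X k)) (hYmeas : ∀ k, Measurable (Y k))
    (hYlat : ∀ k ω, ∃ i ≤ B, Y k ω = (i : ℝ) / B)
    (hYuni : ∀ k, UnimodalOn B (fun i => (P {ω | Y k ω = (i : ℝ) / B}).toReal))
    (hXY : ∀ k, ∀ᵐ ω ∂P, 2 * X k ω ≤ 1 + Y k ω)
    (hpk : ∀ k, pk k ∈ Set.Icc (0 : ℝ) 1)
    (hEY : ∀ k, ∫ ω, Y k ω ∂P = pk k ^ 2)
    (τ : ℝ) (j : ℕ) (hj : 2 ≤ j) (hτ : τ = 1 / 2 + (j : ℝ) / (2 * B)) :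
    (min (1 / 2 + θ ^ 2) (1 / 2 + 1 / (2 * B) + 3 / 4 * θ ^ 2) < τ → τ ≤ 3 / 4 →
      ∑ k ∈ Finset.univ.filter (fun k => pk k ≤ θ), (P {ω | τ ≤ X k ω}).toReal
        ≤ (1 / (2 * (2 * τ - 1 - 1 / (2 * B)))) * θ *
            ∑ k ∈ Finset.univ.filter (fun k => pk k ≤ θ), pk k) ∧
    (3 / 4 < τ → τ ≤ 1 →
      ∑ k ∈ Finset.univ.filter (fun k => pk k ≤ θ), (P {ω | τ ≤ X k ω}).toReal
        ≤ (4 * (1 - τ + 1 / (2 * B)) / (1 + 1 / B)) * θ *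
            ∑ k ∈ Finset.univ.filter (fun k => pk k ≤ θ), pk k) := by
  have hBR : (1 : ℝ) ≤ B := by exact_mod_cast hB
  have hB0 : (0 : ℝ) < B := by linarith
  have hjR : (2 : ℝ) ≤ j := by exact_mod_cast hj
  have hθ0 := hθ.1
  have hθ3 : θ ^ 2 ≤ 1 / 3 := by
    have := pow_le_pow_left₀ hθ0 hθ.2 2
    rwa [div_pow, one_pow, Real.sq_sqrt (by norm_num)] at this
  have hτ2 : 2 * B * τ = B + j := by
    rw [hτ]
    field_simp
  have main : ∀ c M : ℝ, 0 ≤ c → B * θ ^ 2 ≤ M →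
      (∀ b : ℕ, j ≤ b → b ≤ B → (b : ℝ) - j + 1 ≤ c * (b * (b + 1))) →
      2 * M - j + 1 ≤ 2 * c * M * (j + 1) →
      ∑ k ∈ Finset.univ.filter (fun k => pk k ≤ θ), (P {ω | τ ≤ X k ω}).toReal
        ≤ (2 * c * B) * θ * ∑ k ∈ Finset.univ.filter (fun k => pk k ≤ θ), pk k := by
    intro c M hc hM h1 h2
    rw [Finset.mul_sum]
    refine Finset.sum_le_sum fun k hk => ?_
    have hk' : pk k ≤ θ := (Finset.mem_filter.1 hk).2
    have hp0 := (hpk k).1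
    have hsq : pk k ^ 2 ≤ θ ^ 2 := pow_le_pow_left₀ hp0 hk' 2
    have hbound := prob_ge_le_of_unimodal_lattice P B hB (X k) (Y k) (hYmeas k) (hYlat k)
      (hYuni k) (hXY k) τ j hj hτ c M hc (le_trans (by positivity) hM)
      (by rw [hEY]; exact (mul_le_mul_of_nonneg_left hsq hB0.le).trans hM) h1 h2
    rw [hEY] at hbound
    refine hbound.trans ?_
    have : pk k ^ 2 ≤ θ * pk k := by nlinarith
    have := mul_le_mul_of_nonneg_left this (show 0 ≤ 2 * c * B by positivity)
    linarith
  constructor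
  · intro hlow _
    have hd : (0 : ℝ) < 2 * j - 1 := by linarith
    have hM : B * θ ^ 2 ≤ (2 * j - 1) / 3 := by
      rcases min_lt_iff.1 hlow with h | h
      · have := mul_lt_mul_of_pos_left h (show (0 : ℝ) < 2 * B by linarith)
        nlinarith
      · have h' := mul_lt_mul_of_pos_left h (show (0 : ℝ) < 2 * B by linarith)
        have e : 2 * B * (1 / 2 + 1 / (2 * B) + 3 / 4 * θ ^ 2)
            = B + 1 + 3 / 2 * (B * θ ^ 2) := by
          field_simp
          ring
        linarith
    have hC : 1 / (2 * (2 * τ - 1 - 1 / (2 * B))) = 2 * (1 / (2 * (2 * j - 1))) * (B : ℝ) := by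
      have e : 2 * (2 * τ - 1 - 1 / (2 * B)) = (2 * j - 1) / (B : ℝ) := by
        rw [hτ]
        field_simp
        ring
      rw [e]
      field_simp
    rw [hC]
    refine main _ _ (by positivity) hM ?_ ?_
    · intro b hb _
      rw [div_mul_eq_mul_div, le_div_iff₀ (by positivity)]
      have hint : (0 : ℤ) ≤ ((b : ℤ) - (2 * j - 2)) * (b - (2 * j - 1)) := by
        rcases le_or_gt (b : ℤ) (2 * j - 2) with h | h
        · exact mul_nonneg_of_nonpos_of_nonpos (by linarith) (by linarith)
        · exact mul_nonneg (by linarith) (by linarith)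
      have hreal : (0 : ℝ) ≤ ((b : ℝ) - (2 * j - 2)) * (b - (2 * j - 1)) := by exact_mod_cast hint
      nlinarith
    · have e : 2 * (1 / (2 * (2 * (j : ℝ) - 1))) * ((2 * j - 1) / 3) * (j + 1) = (j + 1) / 3 := by
        field_simp
      rw [e]
      linarith
  · intro hlow hup
    have hjB : (j : ℝ) ≤ B := by nlinarith
    have hBj : (B : ℝ) + 1 ≤ 2 * j := by
      have : (B : ℝ) < 2 * j := by nlinarith
      have : B < 2 * j := by exact_mod_cast this
      exact_mod_cast this
    have hC : 4 * (1 - τ + 1 / (2 * B)) / (1 + 1 / B)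
        = 2 * ((B - j + 1) / (B * (B + 1))) * (B : ℝ) := by
      rw [hτ]
      field_simp
      ring
    rw [hC]
    refine main _ (B / 3) (div_nonneg (by linarith) (by positivity)) (by nlinarith) ?_ ?_
    · intro b hjb hbB
      have hjb' : (j : ℝ) ≤ b := by exact_mod_cast hjb
      rw [div_mul_eq_mul_div, le_div_iff₀ (by positivity)]
      rcases hbB.eq_or_lt with rfl | hlt
      · exact le_rfl
      have hlt' : (b : ℝ) + 1 ≤ B := by exact_mod_cast hlt
      have hprod : (b : ℝ) * B ≤ (j - 1) * (b + B + 1) := by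
        have := mul_le_mul (show (b : ℝ) - j + 1 ≤ j - 1 by linarith)
          (show (B : ℝ) - j + 1 ≤ j by linarith) (by linarith) (by linarith)
        linarith
      have := mul_nonneg (show (0 : ℝ) ≤ B - b by linarith) (sub_nonneg.2 hprod)
      linarith
    · have e : 2 * (((B : ℝ) - j + 1) / (B * (B + 1))) * (B / 3) * (j + 1)
          = 2 * (B - j + 1) * (j + 1) / (3 * (B + 1)) := by
        field_simp
      rw [e, le_div_iff₀ (by positivity)]
      nlinarith [mul_nonneg (show (0 : ℝ) ≤ 2 * j - (B + 1) by linarith)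
        (show (0 : ℝ) ≤ 2 * (B + 1) - j - 1 by linarith)]
end

section
/- Let B ≥ 1 be an integer and let X be a random variable taking values in the lattice G = {0, 1/B, 2/B, ..., 1} whose probability mass function is unimodal. Let η = E[X] and suppose η ≤ 1/3. Then for every t = j/B ∈ G with η < t ≤ min((3/2)η + 1/(2B), 2η), one has P(X ≥ t) ≤ (2η − t + 1/B)/(t + 1/B). -/
open MeasureTheory

/-- If `g` has nonpositive sum over every subinterval of `[a, b]` containing `m`, and `f` is
nonnegative and unimodal with mode `m` on `[a, b]`, then `∑ f * g` over `[a, b]` is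
nonpositive. -/
lemma sum_mul_nonpos_of_unimodal (g : ℕ → ℝ) (m n : ℕ) :
    ∀ (a b : ℕ) (f : ℕ → ℝ), b - a = n → a ≤ m → m ≤ b →
      (∀ c d, a ≤ c → c ≤ m → m ≤ d → d ≤ b → ∑ i ∈ Finset.Icc c d, g i ≤ 0) →
      (∀ i, a ≤ i → i ≤ b → 0 ≤ f i) →
      (∀ i k, a ≤ i → i ≤ k → k ≤ m → f i ≤ f k) →
      (∀ i k, m ≤ i → i ≤ k → k ≤ b → f k ≤ f i) →
      ∑ i ∈ Finset.Icc a b, f i * g i ≤ 0 := by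
  induction n with
  | zero =>
    intro a b f hn ham hmb hg hf _ _
    obtain rfl : a = m := by omega
    obtain rfl : b = a := by omega
    have := hg b b le_rfl le_rfl le_rfl le_rfl
    simp only [Finset.Icc_self, Finset.sum_singleton] at this ⊢
    exact mul_nonpos_of_nonneg_of_nonpos (hf b le_rfl le_rfl) this
  | succ n ih =>
    intro a b f hn ham hmb hg hf hl hr
    have split (c : ℝ) : ∑ i ∈ Finset.Icc a b, f i * g i =
        ∑ i ∈ Finset.Icc a b, (f i - c) * g i + c * ∑ i ∈ Finset.Icc a b, g i := by
      rw [Finset.mul_sum, ← Finset.sum_add_distrib]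
      exact Finset.sum_congr rfl fun i _ => by ring
    have hG := hg a b le_rfl ham hmb le_rfl
    have key : (a < m ∧ f a ≤ f b) ∨ (m < b ∧ f b ≤ f a) := by
      rcases ham.lt_or_eq with h | h
      · rcases hmb.lt_or_eq with h' | h'
        · rcases le_total (f a) (f b) with h3 | h3
          · exact Or.inl ⟨h, h3⟩
          · exact Or.inr ⟨h', h3⟩
        · exact Or.inl ⟨h, hl a b le_rfl (by omega) (by omega)⟩
      · exact Or.inr ⟨by omega, hr a b (by omega) (by omega) le_rfl⟩
    rcases key with ⟨h, hab⟩ | ⟨h, hab⟩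
    · have hmin : ∀ i, a ≤ i → i ≤ b → f a ≤ f i := fun i hi hi' => by
        rcases le_total i m with him | him
        · exact hl a i le_rfl hi him
        · exact hab.trans (hr i b him hi' le_rfl)
      have h0 := ih (a + 1) b (fun i => f i - f a) (by omega) h hmb
        (fun c d hc => hg c d (by omega))
        (fun i hi hi' => sub_nonneg.2 (hmin i (by omega) hi'))
        (fun i k hi hk hk' => sub_le_sub_right (hl i k (by omega) hk hk') _)
        (fun i k hi hk hk' => sub_le_sub_right (hr i k hi hk hk') _)
      rw [split (f a), ← Finset.sum_erase (Finset.Icc a b) (a := a) (by simp),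
        Finset.Icc_erase_left, ← Finset.Icc_succ_left_eq_Ioc]
      have := mul_nonpos_of_nonneg_of_nonpos (hf a le_rfl (by omega)) hG
      exact add_nonpos h0 this
    · have hmin : ∀ i, a ≤ i → i ≤ b → f b ≤ f i := fun i hi hi' => by
        rcases le_total i m with him | him
        · exact hab.trans (hl a i le_rfl hi him)
        · exact hr i b him hi' le_rfl
      have h0 := ih a (b - 1) (fun i => f i - f b) (by omega) ham (by omega)
        (fun c d hc hc' hd hd' => hg c d hc hc' hd (by omega))
        (fun i hi hi' => sub_nonneg.2 (hmin i hi (by omega)))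
        (fun i k hi hk hk' => sub_le_sub_right (hl i k hi hk hk') _)
        (fun i k hi hk hk' => sub_le_sub_right (hr i k hi hk (by omega)) _)
      have hI : (Finset.Icc a b).erase b = Finset.Icc a (b - 1) := by
        ext i
        simp only [Finset.mem_erase, Finset.mem_Icc]
        omega
      rw [split (f b), ← Finset.sum_erase (Finset.Icc a b) (a := b) (by simp), hI]
      have := mul_nonpos_of_nonneg_of_nonpos (hf b (by omega) le_rfl) hG
      exact add_nonpos h0 this

lemma sum_Icc_step_sub_linear (C D : ℝ) (j a b : ℕ) (hab : a ≤ b) :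
    ∑ i ∈ Finset.Icc a b, (C * (if j ≤ i then 1 else 0) - (2 * (i : ℝ) - D)) =
      C * (((b + 1 - j : ℕ) : ℝ) - ((a - j : ℕ) : ℝ)) - (a + b - D) * (b - a + 1) := by
  induction b, hab using Nat.le_induction with
  | base =>
    rw [Finset.Icc_self, Finset.sum_singleton]
    split_ifs with h
    · rw [Nat.cast_sub h, Nat.cast_sub (by omega)]
      push_cast
      ring
    · rw [Nat.sub_eq_zero_of_le (by omega : a + 1 ≤ j),
        Nat.sub_eq_zero_of_le (by omega : a ≤ j)]
      push_cast
      ring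
  | succ b hab ih =>
    rw [Finset.sum_Icc_succ_top (by omega), ih]
    split_ifs with h
    · rw [Nat.cast_sub h, Nat.cast_sub (by omega : j ≤ b + 1 + 1)]
      push_cast
      ring
    · rw [Nat.sub_eq_zero_of_le (by omega : b + 1 ≤ j),
        Nat.sub_eq_zero_of_le (by omega : b + 1 + 1 ≤ j)]
      push_cast
      ring

/-- The inequality behind the tail bound for a uniform distribution on `[a, b]` containing a
point `m ≥ j`. -/
lemma sum_Icc_nonpos_of_le_mode (j m a b : ℕ) (hjm : j ≤ m) (ham : a ≤ m) (hmb : m ≤ b) :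
    ∑ i ∈ Finset.Icc a b,
      (((j : ℝ) + 1) * (if j ≤ i then 1 else 0) - (2 * (i : ℝ) - (j - 1))) ≤ 0 := by
  rw [sum_Icc_step_sub_linear _ _ _ _ _ (ham.trans hmb), Nat.cast_sub (by omega)]
  have hab : (a : ℝ) ≤ b := by exact_mod_cast ham.trans hmb
  have hjb : (j : ℝ) ≤ b := by exact_mod_cast hjm.trans hmb
  have ha : (0 : ℝ) ≤ a := a.cast_nonneg
  push_cast
  rcases le_total a j with h | h
  · rw [Nat.sub_eq_zero_of_le h]
    have h' : (a : ℝ) ≤ j := by exact_mod_cast h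
    push_cast
    nlinarith [mul_nonneg ha (sub_nonneg.2 h'), mul_nonneg (sub_nonneg.2 hjb) (sub_nonneg.2 hjb)]
  · rw [Nat.cast_sub h]
    have h' : (j : ℝ) ≤ a := by exact_mod_cast h
    nlinarith [mul_nonneg (by linarith : (0 : ℝ) ≤ b - a + 1)
      (by linarith : (0 : ℝ) ≤ a + b - 2 * j)]

/-- The inequality behind the tail bound for a uniform distribution on `[a, b]` containing a
point `m < j`. -/
lemma sum_Icc_nonpos_of_mode_lt (j m a b : ℕ) (hjm : m < j) (ham : a ≤ m) (hmb : m ≤ b) :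
    ∑ i ∈ Finset.Icc a b,
      ((4 * (j : ℝ) - 2 - 3 * m) * (if j ≤ i then 1 else 0) - (2 * (i : ℝ) - m)) ≤ 0 := by
  rw [sum_Icc_step_sub_linear _ _ _ _ _ (ham.trans hmb),
    Nat.sub_eq_zero_of_le (by omega : a ≤ j)]
  have ha : (0 : ℝ) ≤ a := a.cast_nonneg
  have ham' : (a : ℝ) ≤ m := by exact_mod_cast ham
  have hmb' : (m : ℝ) ≤ b := by exact_mod_cast hmb
  rcases lt_or_ge b j with h | h
  · rw [Nat.sub_eq_zero_of_le (by omega : b + 1 ≤ j)]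
    push_cast
    nlinarith [mul_nonneg (by linarith : (0 : ℝ) ≤ a + b - m)
      (by linarith : (0 : ℝ) ≤ b - a + 1)]
  · rw [Nat.cast_sub (by omega)]
    push_cast
    have key : (4 * (j : ℤ) - 2 - 3 * m) * (b + 1 - j) ≤ (b - m) * (b + 1) := by
      have hsq : (0 : ℤ) ≤ ((b : ℤ) - 2 * j + 1) * (b - 2 * j + 2) := by
        rcases le_or_gt ((b : ℤ) - 2 * j + 2) 0 with h0 | h0
        · exact mul_nonneg_of_nonpos_of_nonpos (by omega) h0
        · exact mul_nonneg (by omega) h0.le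
      have h1 : (0 : ℤ) ≤ ((b : ℤ) - j + 1) * (b - j) := mul_nonneg (by omega) (by omega)
      rcases Nat.lt_or_ge 1 j with hj | hj
      · have h2 := mul_nonneg (by omega : (0 : ℤ) ≤ (j : ℤ) - 1 - m) hsq
        have h3 := mul_nonneg (by omega : (0 : ℤ) ≤ (m : ℤ)) h1
        have hj' : (0 : ℤ) < (j : ℤ) - 1 := by omega
        refine le_of_mul_le_mul_left ?_ hj'
        linarith
      · obtain rfl : j = 1 := by omega
        obtain rfl : m = 0 := by omega
        push_cast at *
        linarith
    have key' : (4 * (j : ℝ) - 2 - 3 * m) * (b + 1 - j) ≤ (b - m) * (b + 1) := by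
      exact_mod_cast key
    linarith [mul_nonneg ha (by linarith : (0 : ℝ) ≤ m + 1 - a)]

/-- Tail bound for a unimodal probability mass function on `{0, ..., B}` with mean `h`. -/
lemma unimodal_tail_le (B j : ℕ) (f : ℕ → ℝ) (hf : ∀ i, 0 ≤ f i) (huni : UnimodalOn B f)
    (hsum : ∑ i ∈ Finset.Icc 0 B, f i = 1) (h : ℝ)
    (hmean : ∑ i ∈ Finset.Icc 0 B, (i : ℝ) * f i = h) (hj : 2 * (j : ℝ) - 1 ≤ 3 * h) :
    (∑ i ∈ Finset.Icc 0 B, (if j ≤ i then (1 : ℝ) else 0) * f i) * (j + 1) ≤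
      2 * h - j + 1 := by
  obtain ⟨m, hmB, hl, hr⟩ := huni
  have expand (C D : ℝ) : ∑ i ∈ Finset.Icc 0 B,
      f i * (C * (if j ≤ i then 1 else 0) - (2 * (i : ℝ) - D)) =
      C * (∑ i ∈ Finset.Icc 0 B, (if j ≤ i then (1 : ℝ) else 0) * f i) - (2 * h - D) := by
    have : D = D * ∑ i ∈ Finset.Icc 0 B, f i := by rw [hsum, mul_one]
    rw [← hmean]
    conv_rhs => rw [this]
    simp only [Finset.mul_sum, ← Finset.sum_sub_distrib]
    exact Finset.sum_congr rfl fun i _ => by ring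
  have main (C D : ℝ) (hG : ∀ c d, 0 ≤ c → c ≤ m → m ≤ d → d ≤ B →
      ∑ i ∈ Finset.Icc c d, (C * (if j ≤ i then 1 else 0) - (2 * (i : ℝ) - D)) ≤ 0) :
      C * (∑ i ∈ Finset.Icc 0 B, (if j ≤ i then (1 : ℝ) else 0) * f i) ≤ 2 * h - D := by
    have := sum_mul_nonpos_of_unimodal _ m _ 0 B f rfl m.zero_le hmB hG (fun i _ _ => hf i)
      (fun i k _ => hl i k) hr
    rw [expand] at this
    linarith
  rcases le_or_gt j m with hjm | hjm
  · have := main (j + 1) (j - 1) fun c d _ hc hd _ => sum_Icc_nonpos_of_le_mode j m c d hjm hc hd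
    linarith
  · have hT := main (4 * j - 2 - 3 * m) m fun c d _ hc hd _ =>
      sum_Icc_nonpos_of_mode_lt j m c d hjm hc hd
    have hmj : (m : ℝ) + 1 ≤ j := by exact_mod_cast hjm
    have hm : (0 : ℝ) ≤ m := m.cast_nonneg
    have hC : 0 < 4 * (j : ℝ) - 2 - 3 * m := by linarith
    refine le_of_mul_le_mul_left ?_ hC
    have h1 := mul_le_mul_of_nonneg_right hT (by linarith : (0 : ℝ) ≤ j + 1)
    have h2 := mul_nonneg (sub_nonneg.2 hj) (by linarith : (0 : ℝ) ≤ j - 1 - m)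
    linarith

/-- The expectation of a function of a lattice-valued random variable as a finite sum. -/
lemma integral_comp_lattice {Ω : Type*} [MeasurableSpace Ω]
    (P : Measure Ω) [IsFiniteMeasure P] (B : ℕ) (hB : 1 ≤ B) (X : Ω → ℝ)
    (hXmeas : Measurable X) (hlat : ∀ ω, ∃ i ≤ B, X ω = (i : ℝ) / B) (φ : ℝ → ℝ) :
    ∫ ω, φ (X ω) ∂P =
      ∑ i ∈ Finset.Icc 0 B, φ ((i : ℝ) / B) * (P {ω | X ω = (i : ℝ) / B}).toReal := by
  have hB' : (B : ℝ) ≠ 0 := by positivity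
  have hmeas (i : ℕ) : MeasurableSet {ω | X ω = (i : ℝ) / B} :=
    hXmeas (measurableSet_singleton _)
  have heq : (fun ω => φ (X ω)) = fun ω => ∑ i ∈ Finset.Icc 0 B,
      {ω | X ω = (i : ℝ) / B}.indicator (fun _ => φ ((i : ℝ) / B)) ω := by
    funext ω
    obtain ⟨k, hk, hX⟩ := hlat ω
    rw [Finset.sum_eq_single_of_mem k (by simp [hk])]
    · simp [hX]
    · intro i _ hik
      refine Set.indicator_of_notMem ?_ _
      rw [Set.mem_ofPred_eq, hX, div_left_inj' hB']
      exact_mod_cast hik.symm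
  rw [heq, integral_finsetSum _ fun i _ => (integrable_const _).indicator (hmeas i)]
  refine Finset.sum_congr rfl fun i _ => ?_
  rw [integral_indicator_const _ (hmeas i), smul_eq_mul, mul_comm]
  rfl

/-- Markov's inequality under unimodality (Theorem 3 of Shah & Samworth (2013)),
first case: if `X` takes values in `{0, 1/B, ..., 1}` with unimodal pmf,
`η = E[X] ≤ 1/3`, and `t = j/B` satisfies `η < t ≤ min(3η/2 + 1/(2B), 2η)`, then
`P(X ≥ t) ≤ (2η - t + 1/B)/(t + 1/B)`. -/
theorem unimodal_markov_case1 {Ω : Type*} [MeasurableSpace Ω]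
    (P : Measure Ω) [IsProbabilityMeasure P]
    (B : ℕ) (hB : 1 ≤ B) (X : Ω → ℝ) (hXmeas : Measurable X)
    (hlat : ∀ ω, ∃ i ≤ B, X ω = (i : ℝ) / B)
    (huni : UnimodalOn B (fun i => (P {ω | X ω = (i : ℝ) / B}).toReal))
    (η : ℝ) (hη : η = ∫ ω, X ω ∂P) (hη3 : η ≤ 1 / 3)
    (j : ℕ) (hjB : j ≤ B) (t : ℝ) (ht : t = (j : ℝ) / B)
    (h1 : η < t) (h2 : t ≤ min (3 / 2 * η + 1 / (2 * B)) (2 * η)) :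
    (P {ω | t ≤ X ω}).toReal ≤ (2 * η - t + 1 / B) / (t + 1 / B) := by
  have hB0 : (0 : ℝ) < B := by exact_mod_cast hB
  have hint := integral_comp_lattice P B hB X hXmeas hlat
  set f : ℕ → ℝ := fun i => (P {ω | X ω = (i : ℝ) / B}).toReal with hf
  have hsum : ∑ i ∈ Finset.Icc 0 B, f i = 1 := by
    have := hint fun _ => 1
    simpa using this.symm
  have hmean : ∑ i ∈ Finset.Icc 0 B, (i : ℝ) * f i = B * η := by
    rw [hη, hint fun x => x, Finset.mul_sum]
    refine Finset.sum_congr rfl fun i _ => ?_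
    rw [← mul_assoc, mul_div_cancel₀ (i : ℝ) hB0.ne']
  have htail : (P {ω | t ≤ X ω}).toReal =
      ∑ i ∈ Finset.Icc 0 B, (if j ≤ i then (1 : ℝ) else 0) * f i := by
    have h3 := hint ((Set.Ici t).indicator 1)
    have h4 : ∫ ω, (Set.Ici t).indicator (1 : ℝ → ℝ) (X ω) ∂P = (P {ω | t ≤ X ω}).toReal :=
      integral_indicator_one (hXmeas measurableSet_Ici)
    rw [← h4, h3]
    refine Finset.sum_congr rfl fun i _ => ?_
    simp only [hf, Set.indicator_apply, Set.mem_Ici, ht, div_le_div_iff_of_pos_right hB0,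
      Nat.cast_le, Pi.one_apply]
  have hj : 2 * (j : ℝ) - 1 ≤ 3 * (B * η) := by
    have h3 := h2.trans (min_le_left _ _)
    rw [ht, div_le_iff₀ hB0] at h3
    have h4 : (3 / 2 * η + 1 / (2 * B)) * B = 3 / 2 * (B * η) + 1 / 2 := by field_simp
    linarith
  have hfin := unimodal_tail_le B j f (fun _ => ENNReal.toReal_nonneg) huni hsum _ hmean hj
  have hrhs : (2 * η - t + 1 / B) / (t + 1 / B) = (2 * (B * η) - j + 1) / ((j : ℝ) + 1) := by
    rw [ht]
    field_simp
  rw [htail, hrhs, le_div_iff₀ (by positivity)]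
  exact hfin
end

section
/- Let B ≥ 1 be an integer and let X be a random variable taking values in the lattice G = {0, 1/B, 2/B, ..., 1} whose probability mass function is unimodal. Let η = E[X] and suppose η ≤ 1/3. Then for every t = j/B ∈ G with min((3/2)η + 1/(2B), 2η) < t ≤ 1/2, one has P(X ≥ t) ≤ η/(2t − 1/B). -/
open MeasureTheory

/-- A function increasing on `{0, ..., m}` correlates nonnegatively with `i ↦ 2 * i - m`. -/
lemma sum_range_centered_mul_nonneg (f : ℕ → ℝ) (m : ℕ)
    (hf : ∀ i k, i ≤ k → k ≤ m → f i ≤ f k) :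
    0 ≤ ∑ i ∈ Finset.range (m + 1), (2 * (i : ℝ) - m) * f i := by
  have hrefl := Finset.sum_range_reflect (fun i : ℕ => (2 * (i : ℝ) - m) * f i) (m + 1)
  have hsum : 0 ≤ ∑ i ∈ Finset.range (m + 1), ((2 * (i : ℝ) - m) * f i +
      (2 * ((m + 1 - 1 - i : ℕ) : ℝ) - m) * f (m + 1 - 1 - i)) := by
    refine Finset.sum_nonneg fun i hi => ?_
    have him : i ≤ m := Nat.lt_succ_iff.mp (Finset.mem_range.mp hi)
    simp only [Nat.add_sub_cancel, Nat.cast_sub him]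
    rcases le_total i (m - i) with h | h
    · have hfi := hf i (m - i) h (Nat.sub_le _ _)
      have hcast : (2 * i : ℝ) ≤ m := by exact_mod_cast (by omega : 2 * i ≤ m)
      nlinarith
    · have hfi := hf (m - i) i h him
      have hcast : (m : ℝ) ≤ 2 * i := by exact_mod_cast (by omega : m ≤ 2 * i)
      nlinarith
  rw [Finset.sum_add_distrib, hrefl] at hsum
  linarith

/-- The key linear inequality: for a nonnegative `f` increasing on `{0, ..., m}` and crossing the
level `f (m + 1 + n)` downwards at `m + 1 + n`, the tail sum from `m + 1 + n` is controlled by the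
first moment. -/
lemma sum_range_mul_tail_nonneg (f : ℕ → ℝ) (m n r : ℕ) (h0 : ∀ i, 0 ≤ f i)
    (hmono : ∀ i k, i ≤ k → k ≤ m → f i ≤ f k)
    (hleft : ∀ k < n, f (m + 1 + n) ≤ f (m + 1 + k))
    (hright : ∀ k < n, f (m + 1 + n + k) ≤ f (m + 1 + n)) :
    0 ≤ ∑ i ∈ Finset.range (m + 1 + n + n + r),
      (2 * (i : ℝ) - m - if m + 1 + n ≤ i then (m : ℝ) + 4 * n + 2 else 0) * f i := by
  rw [Finset.sum_range_add, Finset.sum_range_add _ (m + 1 + n), Finset.sum_range_add _ (m + 1)]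
  have hhead : ∑ i ∈ Finset.range (m + 1),
      (2 * (i : ℝ) - m - if m + 1 + n ≤ i then (m : ℝ) + 4 * n + 2 else 0) * f i =
      ∑ i ∈ Finset.range (m + 1), (2 * (i : ℝ) - m) * f i := by
    refine Finset.sum_congr rfl fun i hi => ?_
    rw [if_neg (by have := Finset.mem_range.mp hi; omega), sub_zero]
  have hhead_nonneg := sum_range_centered_mul_nonneg f m hmono
  have htail : 0 ≤ ∑ x ∈ Finset.range r, (2 * ((m + 1 + n + n + x : ℕ) : ℝ) - m -
      if m + 1 + n ≤ m + 1 + n + n + x then (m : ℝ) + 4 * n + 2 else 0) *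
        f (m + 1 + n + n + x) := by
    refine Finset.sum_nonneg fun x _ => mul_nonneg ?_ (h0 _)
    rw [if_pos (by omega)]
    push_cast
    have : (0 : ℝ) ≤ x := x.cast_nonneg
    have : (0 : ℝ) ≤ m := m.cast_nonneg
    linarith
  have hbalance : ∑ k ∈ Finset.range n, (2 * (2 * (k : ℝ) + 1 - n)) = 0 := by
    have hG : ∀ N : ℕ, ∑ k ∈ Finset.range N, (2 * (2 * (k : ℝ) + 1 - n)) = 2 * N * (N - n) := by
      intro N
      induction N with
      | zero => simp
      | succ N ih => rw [Finset.sum_range_succ, ih]; push_cast; ring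
    rw [hG]; ring
  have hmiddle : ∑ k ∈ Finset.range n, (2 * (2 * (k : ℝ) + 1 - n)) * f (m + 1 + n) ≤
      ∑ x ∈ Finset.range n, (2 * ((m + 1 + x : ℕ) : ℝ) - m -
        if m + 1 + n ≤ m + 1 + x then (m : ℝ) + 4 * n + 2 else 0) * f (m + 1 + x) +
      ∑ x ∈ Finset.range n, (2 * ((m + 1 + n + x : ℕ) : ℝ) - m -
        if m + 1 + n ≤ m + 1 + n + x then (m : ℝ) + 4 * n + 2 else 0) * f (m + 1 + n + x) := by
    rw [← Finset.sum_add_distrib]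
    refine Finset.sum_le_sum fun k hk => ?_
    have hkn := Finset.mem_range.mp hk
    rw [if_neg (by omega), if_pos (by omega)]
    push_cast
    have hkn' : (k : ℝ) ≤ n := by exact_mod_cast hkn.le
    have hl : 0 ≤ (2 * (k : ℝ) + 2) * (f (m + 1 + k) - f (m + 1 + n)) :=
      mul_nonneg (by positivity) (sub_nonneg.mpr (hleft k hkn))
    have hr : 0 ≤ (2 * ((n : ℝ) - k)) * (f (m + 1 + n) - f (m + 1 + n + k)) :=
      mul_nonneg (by linarith) (sub_nonneg.mpr (hright k hkn))
    have hm : 0 ≤ (m : ℝ) * f (m + 1 + k) := mul_nonneg m.cast_nonneg (h0 _)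
    linarith
  rw [← Finset.sum_mul, hbalance, zero_mul] at hmiddle
  linarith

/-- The expectation of a function of a lattice-valued random variable is a finite sum against its
probability mass function. -/
lemma integral_comp_of_lattice {Ω : Type*} [MeasurableSpace Ω]
    (P : Measure Ω) [IsFiniteMeasure P] (B : ℕ) (hB : 1 ≤ B) (X : Ω → ℝ) (hX : Measurable X)
    (hlat : ∀ ω, ∃ i ≤ B, X ω = (i : ℝ) / B) (N : ℕ) (hN : B < N) (φ : ℝ → ℝ) :
    ∫ ω, φ (X ω) ∂P =
      ∑ i ∈ Finset.range N, φ ((i : ℝ) / B) * (P {ω | X ω = (i : ℝ) / B}).toReal := by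
  have hB0 : (B : ℝ) ≠ 0 := by positivity
  have hmeas : ∀ i : ℕ, MeasurableSet {ω | X ω = (i : ℝ) / B} := fun i =>
    hX (measurableSet_singleton ((i : ℝ) / B))
  have hdecomp : (fun ω => φ (X ω)) = fun ω => ∑ i ∈ Finset.range N,
      ({ω | X ω = (i : ℝ) / B} : Set Ω).indicator (fun _ => φ ((i : ℝ) / B)) ω := by
    funext ω
    obtain ⟨k, hk, hXk⟩ := hlat ω
    rw [Finset.sum_eq_single_of_mem k (Finset.mem_range.mpr (hk.trans_lt hN))]
    · rw [Set.indicator_of_mem (show ω ∈ {ω | X ω = (k : ℝ) / B} from hXk), hXk]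
    · intro i _ hik
      refine Set.indicator_of_notMem (fun h => hik ?_) _
      have h' : (i : ℝ) / B = (k : ℝ) / B := (show X ω = (i : ℝ) / B from h).symm.trans hXk
      exact_mod_cast (div_left_inj' hB0).mp h'
  rw [hdecomp, integral_finsetSum _ fun i _ => (integrable_const _).indicator (hmeas i)]
  refine Finset.sum_congr rfl fun i _ => ?_
  rw [integral_indicator_const _ (hmeas i), smul_eq_mul, mul_comm, Measure.real]

/-- Markov's inequality under unimodality (Theorem 3 of Shah & Samworth (2013)),
second case: if `X` takes values in `{0, 1/B, ..., 1}` with unimodal pmf,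
`η = E[X] ≤ 1/3`, and `t = j/B` satisfies `min(3η/2 + 1/(2B), 2η) < t ≤ 1/2`, then
`P(X ≥ t) ≤ η/(2t - 1/B)`. -/
theorem unimodal_markov_case2 {Ω : Type*} [MeasurableSpace Ω]
    (P : Measure Ω) [IsProbabilityMeasure P]
    (B : ℕ) (hB : 1 ≤ B) (X : Ω → ℝ) (hXmeas : Measurable X)
    (hlat : ∀ ω, ∃ i ≤ B, X ω = (i : ℝ) / B)
    (huni : UnimodalOn B (fun i => (P {ω | X ω = (i : ℝ) / B}).toReal))
    (η : ℝ) (hη : η = ∫ ω, X ω ∂P) (hη3 : η ≤ 1 / 3)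
    (j : ℕ) (hjB : j ≤ B) (t : ℝ) (ht : t = (j : ℝ) / B)
    (h1 : min (3 / 2 * η + 1 / (2 * B)) (2 * η) < t) (h2 : t ≤ 1 / 2) :
    (P {ω | t ≤ X ω}).toReal ≤ η / (2 * t - 1 / B) := by
  have hBpos : (0 : ℝ) < B := by exact_mod_cast hB
  obtain ⟨m₀, hm₀, hinc, hdec⟩ := huni
  set f : ℕ → ℝ := fun i => (P {ω | X ω = (i : ℝ) / B}).toReal with hf
  have h0 : ∀ i, 0 ≤ f i := fun i => ENNReal.toReal_nonneg
  have hfB : ∀ i, B < i → f i = 0 := by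
    intro i hi
    have hempty : {ω | X ω = (i : ℝ) / B} = ∅ := by
      refine Set.eq_empty_iff_forall_notMem.mpr fun ω hω => ?_
      obtain ⟨k, hk, hXk⟩ := hlat ω
      have h' : (i : ℝ) / B = (k : ℝ) / B := (show X ω = (i : ℝ) / B from hω).symm.trans hXk
      have : i = k := by exact_mod_cast (div_left_inj' hBpos.ne').mp h'
      omega
    simp [hf, hempty]
  have hanti : ∀ i k, m₀ ≤ i → i ≤ k → f k ≤ f i := by
    intro i k hi hik
    rcases le_or_gt k B with hk | hk
    · exact hdec i k hi hik hk
    · rw [hfB k hk]; exact h0 i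
  have hηnonneg : 0 ≤ η := by
    rw [hη]
    refine integral_nonneg fun ω => ?_
    obtain ⟨k, -, hXk⟩ := hlat ω
    rw [Pi.zero_apply, hXk]; positivity
  have hj : 1 ≤ j := by
    by_contra hj
    obtain rfl : j = 0 := by omega
    have : 0 ≤ min (3 / 2 * η + 1 / (2 * (B : ℝ))) (2 * η) := le_min (by positivity) (by positivity)
    rw [ht] at h1
    simp only [Nat.cast_zero, zero_div] at h1
    linarith
  have hmean : 2 ≤ j → 3 * (η * B) ≤ 2 * j - 1 := by
    intro hj2
    have hj2' : (2 : ℝ) ≤ j := by exact_mod_cast hj2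
    rw [ht] at h1
    rcases min_lt_iff.mp h1 with h | h
    · rw [lt_div_iff₀ hBpos] at h
      have : (3 / 2 * η + 1 / (2 * (B : ℝ))) * B = 3 / 2 * (η * B) + 1 / 2 := by field_simp
      linarith
    · rw [lt_div_iff₀ hBpos] at h
      linarith
  obtain ⟨m, n, hjmn, hmm₀, hn⟩ : ∃ m n, j = m + 1 + n ∧ m ≤ m₀ ∧ (n = 0 ∨ m = m₀) := by
    rcases le_total (j - 1) m₀ with h | h
    · exact ⟨j - 1, 0, by omega, h, Or.inl rfl⟩
    · exact ⟨m₀, j - 1 - m₀, by omega, le_rfl, Or.inr rfl⟩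
  have key := sum_range_mul_tail_nonneg f m n (B + 1) h0
    (fun i k hik hk => hinc i k hik (hk.trans hmm₀))
    (fun k hk => hanti _ _ (by omega) (by omega))
    (fun k hk => hanti _ _ (by omega) (by omega))
  rw [← hjmn] at key
  have hlattice : ∀ φ : ℝ → ℝ, ∫ ω, φ (X ω) ∂P =
      ∑ i ∈ Finset.range (j + n + (B + 1)), φ ((i : ℝ) / B) * f i :=
    integral_comp_of_lattice P B hB X hXmeas hlat (j + n + (B + 1)) (by omega)
  have hone := hlattice fun _ => 1
  have hexp := hlattice fun x => x
  have htail := hlattice ({x | t ≤ x}.indicator fun _ => 1)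
  have hprob : ∫ ω, ({x | t ≤ x}.indicator fun _ => (1 : ℝ)) (X ω) ∂P =
      (P {ω | t ≤ X ω}).toReal :=
    integral_indicator_one (μ := P) (hXmeas measurableSet_Ici)
  rw [hprob] at htail
  simp only [integral_const, probReal_univ, smul_eq_mul, mul_one, one_mul] at hone
  rw [← hη] at hexp
  set q := (P {ω | t ≤ X ω}).toReal
  have hsplit : ∑ i ∈ Finset.range (j + n + (B + 1)),
      (2 * (i : ℝ) - m - if j ≤ i then (m : ℝ) + 4 * n + 2 else 0) * f i =
      2 * (η * B) - m - (m + 4 * n + 2) * q := by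
    have hm1 : 2 * (η * B) - m - (m + 4 * n + 2) * q =
        2 * (η * B) - m * (∑ i ∈ Finset.range (j + n + (B + 1)), f i) - (m + 4 * n + 2) * q := by
      rw [← hone, mul_one]
    rw [hm1, hexp, htail, Finset.sum_mul, Finset.mul_sum, Finset.mul_sum, Finset.mul_sum,
      ← Finset.sum_sub_distrib, ← Finset.sum_sub_distrib]
    refine Finset.sum_congr rfl fun i _ => ?_
    have hiff : t ≤ (i : ℝ) / B ↔ j ≤ i := by
      rw [ht, div_le_div_iff_of_pos_right hBpos, Nat.cast_le]
    simp only [Set.indicator_apply, Set.mem_ofPred_eq, hiff]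
    split_ifs <;> field_simp <;> ring
  rw [hsplit] at key
  have hjcast : (j : ℝ) = m + 1 + n := by exact_mod_cast hjmn
  have hden : 2 * t - 1 / B = (2 * j - 1) / B := by rw [ht]; ring
  have hm_nonneg : (0 : ℝ) ≤ m := m.cast_nonneg
  have hn_nonneg : (0 : ℝ) ≤ n := n.cast_nonneg
  have hc : (0 : ℝ) < 2 * j - 1 := by linarith
  rw [hden, div_div_eq_mul_div, le_div_iff₀ hc]
  have hm_mean : 0 ≤ (m : ℝ) * (2 * j - 1 - 3 * (η * B)) := by
    rcases Nat.eq_zero_or_pos m with hm | hm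
    · simp [hm]
    · exact mul_nonneg hm_nonneg (sub_nonneg.mpr (hmean (by omega)))
  have hd : (0 : ℝ) < m + 4 * n + 2 := by positivity
  refine le_of_mul_le_mul_left ?_ hd
  have hscaled := mul_nonneg hc.le key
  rw [hjcast] at hscaled hm_mean ⊢
  linarith
end

section
/- Let B ≥ 2 be an integer and let f : {0, 1, ..., B} → ℝ be a probability mass function (f_i ≥ 0, ∑_{i=0}^B f_i = 1). Suppose there exist l ≤ u in {0,...,B} such that f_0 < f_1 < ... < f_l, f_l = f_{l+1} = ... = f_u, and f_u > f_{u+1} > ... > f_B. Then there exists r < 0 such that for every i ∈ {1, ..., B−1} with f_{i−1} > 0 and f_{i+1} > 0, one has f_i^r ≤ (1/2)(f_{i−1}^r + f_{i+1}^r); that is, f is r-concave for some r < 0. -/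
open Filter in
/-- Raising to a sufficiently negative power separates two positive reals by a factor of two. -/
lemma eventually_atBot_rpow_le_half_rpow {a b : ℝ} (ha : 0 < a) (hab : a < b) :
    ∀ᶠ r : ℝ in atBot, b ^ r ≤ a ^ r / 2 := by
  have hb : 0 < b := ha.trans hab
  have h := (tendsto_rpow_atBot_of_base_lt_one (a / b) (div_pos ha hb)
    ((div_lt_one hb).2 hab)).eventually_ge_atTop 2
  filter_upwards [h] with r hr
  rw [Real.div_rpow ha.le hb.le, le_div_iff₀ (Real.rpow_pos_of_pos hb r)] at hr
  linarith

open Filter in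
/-- If `b` exceeds one of its positive neighbours `a`, `c`, or equals both, then the three-term
`r`-concavity inequality holds for all sufficiently negative `r`. -/
lemma eventually_atBot_rpow_le_midpoint {a b c : ℝ} (ha : 0 < a) (hc : 0 < c)
    (h : a < b ∨ c < b ∨ (a = b ∧ c = b)) :
    ∀ᶠ r : ℝ in atBot, b ^ r ≤ (a ^ r + c ^ r) / 2 := by
  rcases h with h | h | ⟨rfl, rfl⟩
  · filter_upwards [eventually_atBot_rpow_le_half_rpow ha h] with r hr
    linarith [Real.rpow_nonneg hc.le r]
  · filter_upwards [eventually_atBot_rpow_le_half_rpow hc h] with r hr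
    linarith [Real.rpow_nonneg ha.le r]
  · exact Eventually.of_forall fun r => by linarith

/-- Proposition 2 of Shah & Samworth (2013): a probability mass function on
`{0, 1, ..., B}` that is strictly increasing up to `l`, constant on `{l, ..., u}`,
and strictly decreasing from `u` onwards is `r`-concave for some `r < 0`, in the
sense that `f_i ^ r ≤ (f_{i-1} ^ r + f_{i+1} ^ r) / 2` at every interior index whose
neighbours carry positive mass. -/
theorem unimodal_pmf_rConcave (B : ℕ) (hB : 2 ≤ B) (f : ℕ → ℝ)
    (hnn : ∀ i, 0 ≤ f i) (hsum : ∑ i ∈ Finset.range (B + 1), f i = 1)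
    (l u : ℕ) (hlu : l ≤ u) (huB : u ≤ B)
    (hinc : ∀ i, i < l → f i < f (i + 1))
    (hflat : ∀ i, l ≤ i → i < u → f i = f (i + 1))
    (hdec : ∀ i, u ≤ i → i < B → f (i + 1) < f i) :
    ∃ r : ℝ, r < 0 ∧ ∀ i, 1 ≤ i → i + 1 ≤ B → 0 < f (i - 1) → 0 < f (i + 1) →
      f i ^ r ≤ (f (i - 1) ^ r + f (i + 1) ^ r) / 2 := by
  have key : ∀ i ∈ Finset.range B, ∀ᶠ r : ℝ in Filter.atBot,
      1 ≤ i → i + 1 ≤ B → 0 < f (i - 1) → 0 < f (i + 1) →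
        f i ^ r ≤ (f (i - 1) ^ r + f (i + 1) ^ r) / 2 := by
    intro i _
    simp only [Filter.eventually_imp_distrib_left]
    intro hi hiB ha hc
    refine eventually_atBot_rpow_le_midpoint ha hc ?_
    obtain ⟨j, rfl⟩ := Nat.exists_eq_add_of_le' hi
    rw [Nat.add_sub_cancel]
    by_cases hl : j < l
    · exact Or.inl (hinc j hl)
    by_cases hu : u ≤ j + 1
    · exact Or.inr (Or.inl (hdec _ hu hiB))
    · exact Or.inr (Or.inr ⟨hflat j (by omega) (by omega),
        (hflat (j + 1) (by omega) (by omega)).symm⟩)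
  obtain ⟨r, hr, hneg⟩ :=
    (((Filter.eventually_all_finset _).2 key).and (Filter.eventually_lt_atBot 0)).exists
  exact ⟨r, hneg, fun i hi hiB => hr i (Finset.mem_range.2 hiB) hi hiB⟩
end

section
/- Let n ≥ 1 and let x = (x_1,...,x_n) and y = (y_1,...,y_n) be vectors in ℝⁿ with ∑_{i=1}^n x_i = ∑_{i=1}^n y_i, and suppose there exists i* ∈ {1,...,n} such that x_i ≥ y_i for all i ≤ i* and x_i ≤ y_i for all i > i*. Then ∑_{i=1}^n i·x_i = ∑_{i=1}^n i·y_i holds if and only if x_i = y_i for every i ∈ {1,...,n}. -/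
/-- Proposition 3 of Shah & Samworth (2013), equality case: if `x` and `y` have
equal sums over `{1, ..., n}` and `x` dominates `y` up to some index `i*` and is
dominated by `y` afterwards, then `∑ i·x_i = ∑ i·y_i` holds if and only if
`x_i = y_i` for every `i ∈ {1, ..., n}`. -/
theorem crossing_weighted_sum_eq_iff (n : ℕ) (hn : 1 ≤ n) (x y : ℕ → ℝ)
    (hsum : ∑ i ∈ Finset.Icc 1 n, x i = ∑ i ∈ Finset.Icc 1 n, y i)
    (istar : ℕ) (histar : istar ∈ Finset.Icc 1 n)
    (h1 : ∀ i, 1 ≤ i → i ≤ istar → y i ≤ x i)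
    (h2 : ∀ i, istar < i → i ≤ n → x i ≤ y i) :
    (∑ i ∈ Finset.Icc 1 n, (i : ℝ) * x i = ∑ i ∈ Finset.Icc 1 n, (i : ℝ) * y i) ↔
      ∀ i, 1 ≤ i → i ≤ n → x i = y i := by
  refine ⟨fun hw => ?_, fun h => Finset.sum_congr rfl fun i hi => ?_⟩
  · have hzero : ∑ i ∈ Finset.Icc 1 n, ((i : ℝ) - (istar + 1 / 2)) * (y i - x i) = 0 := by
      simp only [sub_mul, mul_sub, Finset.sum_sub_distrib, ← Finset.mul_sum]
      rw [hw, hsum]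
      ring
    have hnonneg : ∀ i ∈ Finset.Icc 1 n,
        0 ≤ ((i : ℝ) - (istar + 1 / 2)) * (y i - x i) := by
      intro i hi
      obtain ⟨hi1, hin⟩ := Finset.mem_Icc.mp hi
      rcases le_or_gt i istar with hle | hlt
      · have hcast : (i : ℝ) ≤ istar := by exact_mod_cast hle
        exact mul_nonneg_of_nonpos_of_nonpos (by linarith) (by linarith [h1 i hi1 hle])
      · have hcast : (istar : ℝ) + 1 ≤ i := by exact_mod_cast hlt
        exact mul_nonneg (by linarith) (by linarith [h2 i hlt hin])
    intro i hi1 hin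
    have hterm := (Finset.sum_eq_zero_iff_of_nonneg hnonneg).mp hzero i
      (Finset.mem_Icc.mpr ⟨hi1, hin⟩)
    have hne : (i : ℝ) - (istar + 1 / 2) ≠ 0 := by
      rcases le_or_gt i istar with hle | hlt
      · have hcast : (i : ℝ) ≤ istar := by exact_mod_cast hle
        exact ne_of_lt (by linarith)
      · have hcast : (istar : ℝ) + 1 ≤ i := by exact_mod_cast hlt
        exact ne_of_gt (by linarith)
    exact (sub_eq_zero.mp ((mul_eq_zero.mp hterm).resolve_left hne)).symm
  · obtain ⟨hi1, hin⟩ := Finset.mem_Icc.mp hi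
    rw [h i hi1 hin]
end

section
/- Let B ≥ 1 be an integer, let η ∈ ℝ with η > 0, and let t = j/B for some integer j ∈ {1, ..., B} with η < t. Let U_η be the set of unimodal probability mass functions f on {0, 1, ..., B} with mean E(f) = ∑_{i=0}^B (i/B) f_i ≤ η, and let T_t(f) = ∑_{i=j}^B f_i. If f* ∈ U_η satisfies T_t(f*) ≥ T_t(g) for all g ∈ U_η, then E(f*) = η. -/
/-- A probability mass function on the lattice `{0, 1/B, ..., 1}`, indexed by
`{0, 1, ..., B}` and extended by zero beyond `B`. -/
def LatticePMF (B : ℕ) (f : ℕ → ℝ) : Prop :=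
  (∀ i, 0 ≤ f i) ∧ (∀ i, B < i → f i = 0) ∧ ∑ i ∈ Finset.range (B + 1), f i = 1

/-- The mean `E(f) = ∑_{i=0}^B (i/B) f_i` of a pmf on `{0, 1/B, ..., 1}`. -/
noncomputable def pmfMean (B : ℕ) (f : ℕ → ℝ) : ℝ :=
  ∑ i ∈ Finset.range (B + 1), ((i : ℝ) / B) * f i

/-- The tail probability `T_{j/B}(f) = ∑_{i=j}^B f_i`. -/
noncomputable def pmfTail (B j : ℕ) (f : ℕ → ℝ) : ℝ :=
  ∑ i ∈ Finset.Icc j B, f i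

/-- `m` is a mode of `f` on `{0, 1, ..., B}`. -/
def IsModeOn (B : ℕ) (f : ℕ → ℝ) (m : ℕ) : Prop :=
  (∀ i j, i ≤ j → j ≤ m → f i ≤ f j) ∧ (∀ i j, m ≤ i → i ≤ j → j ≤ B → f j ≤ f i)

lemma IsModeOn.mix {B m : ℕ} {f h : ℕ → ℝ} (hf : IsModeOn B f m) (hh : IsModeOn B h m)
    {ε : ℝ} (h0 : 0 ≤ ε) (h1 : ε ≤ 1) :
    IsModeOn B (fun i => (1 - ε) * f i + ε * h i) m := by
  have h2 : 0 ≤ 1 - ε := by linarith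
  refine ⟨fun i j hij hj => ?_, fun i j hi hij hj => ?_⟩
  · have := hf.1 i j hij hj
    have := hh.1 i j hij hj
    dsimp only
    gcongr
  · have := hf.2 i j hi hij hj
    have := hh.2 i j hi hij hj
    dsimp only
    gcongr

lemma LatticePMF.mix {B : ℕ} {f h : ℕ → ℝ} (hf : LatticePMF B f) (hh : LatticePMF B h)
    {ε : ℝ} (h0 : 0 ≤ ε) (h1 : ε ≤ 1) :
    LatticePMF B (fun i => (1 - ε) * f i + ε * h i) := by
  have h2 : 0 ≤ 1 - ε := by linarith
  refine ⟨fun i => ?_, fun i hi => ?_, ?_⟩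
  · have := hf.1 i
    have := hh.1 i
    positivity
  · simp [hf.2.1 i hi, hh.2.1 i hi]
  · rw [Finset.sum_add_distrib, ← Finset.mul_sum, ← Finset.mul_sum, hf.2.2, hh.2.2]
    ring

lemma pmfMean_mix (B : ℕ) (f h : ℕ → ℝ) (ε : ℝ) :
    pmfMean B (fun i => (1 - ε) * f i + ε * h i) =
      (1 - ε) * pmfMean B f + ε * pmfMean B h := by
  unfold pmfMean
  rw [Finset.mul_sum, Finset.mul_sum, ← Finset.sum_add_distrib]
  exact Finset.sum_congr rfl fun i _ => by ring

lemma pmfTail_mix (B j : ℕ) (f h : ℕ → ℝ) (ε : ℝ) :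
    pmfTail B j (fun i => (1 - ε) * f i + ε * h i) =
      (1 - ε) * pmfTail B j f + ε * pmfTail B j h := by
  unfold pmfTail
  rw [Finset.mul_sum, Finset.mul_sum, ← Finset.sum_add_distrib]

lemma LatticePMF.pmfMean_nonneg {B : ℕ} {f : ℕ → ℝ} (hf : LatticePMF B f) :
    0 ≤ pmfMean B f :=
  Finset.sum_nonneg fun i _ => mul_nonneg (by positivity) (hf.1 i)

lemma LatticePMF.pmfMean_le_one {B : ℕ} {f : ℕ → ℝ} (hf : LatticePMF B f) :
    pmfMean B f ≤ 1 := by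
  rw [← hf.2.2]
  refine Finset.sum_le_sum fun i hi => mul_le_of_le_one_left (hf.1 i) ?_
  have : i ≤ B := Nat.lt_succ_iff.mp (Finset.mem_range.mp hi)
  exact div_le_one_of_le₀ (by exact_mod_cast this) (by positivity)

lemma Icc_subset_range_succ (j B : ℕ) : Finset.Icc j B ⊆ Finset.range (B + 1) := fun i hi => by
  simp only [Finset.mem_Icc, Finset.mem_range] at hi ⊢
  omega

/-- Markov's inequality on the lattice. -/
lemma LatticePMF.mul_pmfTail_le_pmfMean {B : ℕ} {f : ℕ → ℝ} (hf : LatticePMF B f) (j : ℕ) :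
    (j : ℝ) / B * pmfTail B j f ≤ pmfMean B f := by
  unfold pmfTail pmfMean
  rw [Finset.mul_sum]
  calc ∑ i ∈ Finset.Icc j B, (j : ℝ) / B * f i
      ≤ ∑ i ∈ Finset.Icc j B, (i : ℝ) / B * f i := by
        refine Finset.sum_le_sum fun i hi => mul_le_mul_of_nonneg_right ?_ (hf.1 i)
        have : j ≤ i := (Finset.mem_Icc.mp hi).1
        gcongr
    _ ≤ _ := Finset.sum_le_sum_of_subset_of_nonneg (Icc_subset_range_succ j B)
        fun i _ _ => mul_nonneg (by positivity) (hf.1 i)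

lemma latticePMF_single {B m : ℕ} (hm : m ≤ B) : LatticePMF B (Pi.single m 1) := by
  refine ⟨fun i => ?_, fun i hi => ?_, ?_⟩
  · rw [Pi.single_apply]
    split_ifs <;> norm_num
  · exact Pi.single_eq_of_ne (by omega) _
  · rw [Finset.sum_pi_single', if_pos (Finset.mem_range.mpr (by omega))]

lemma isModeOn_single (B m : ℕ) : IsModeOn B (Pi.single m 1) m := by
  constructor
  · intro i j hij hj
    simp only [Pi.single_apply]
    split_ifs <;> first | omega | norm_num
  · intro i j hi hij hj
    simp only [Pi.single_apply]
    split_ifs <;> first | omega | norm_num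

lemma pmfTail_single {B j m : ℕ} (hj : j ≤ m) (hm : m ≤ B) :
    pmfTail B j (Pi.single m 1) = 1 := by
  unfold pmfTail
  rw [Finset.sum_pi_single', if_pos (Finset.mem_Icc.mpr ⟨hj, hm⟩)]

/-- The uniform distribution on `{m, ..., B}`. -/
noncomputable def uniformFrom (B m : ℕ) (i : ℕ) : ℝ :=
  if m ≤ i ∧ i ≤ B then ((B : ℝ) + 1 - m)⁻¹ else 0

lemma pmfTail_uniformFrom {B j m : ℕ} (hm : m ≤ j) (hj : j ≤ B) :
    pmfTail B j (uniformFrom B m) = ((B : ℝ) + 1 - j) * ((B : ℝ) + 1 - m)⁻¹ := by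
  unfold pmfTail
  rw [Finset.sum_congr rfl (g := fun _ => ((B : ℝ) + 1 - m)⁻¹) fun i hi => ?_]
  · simp [Nat.cast_sub (show j ≤ B + 1 by omega)]
  · rw [Finset.mem_Icc] at hi
    exact if_pos ⟨by omega, by omega⟩

lemma latticePMF_uniformFrom {B m : ℕ} (hm : m ≤ B) : LatticePMF B (uniformFrom B m) := by
  have hm' : (m : ℝ) ≤ B := by exact_mod_cast hm
  have hpos : 0 < (B : ℝ) + 1 - m := by linarith
  refine ⟨fun i => ?_, fun i hi => if_neg (by omega), ?_⟩
  · unfold uniformFrom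
    split_ifs <;> positivity
  · rw [← Finset.sum_subset (Icc_subset_range_succ m B)]
    · exact (pmfTail_uniformFrom le_rfl hm).trans (mul_inv_cancel₀ hpos.ne')
    · intro i _ hi
      exact if_neg (by simpa using hi)

lemma isModeOn_uniformFrom {B m : ℕ} (hm : m ≤ B) : IsModeOn B (uniformFrom B m) m := by
  have h := (latticePMF_uniformFrom hm).1
  constructor
  · intro i j hij hj
    by_cases hi : m ≤ i
    · rw [show i = j by omega]
    · exact (if_neg (by omega) : uniformFrom B m i = 0).trans_le (h j)
  · intro i j hi hij hj
    unfold uniformFrom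
    rw [if_pos (by omega), if_pos (by omega)]

/-- A pmf decreasing strictly somewhere between its mode `m` and `j` has a tail lighter than the
uniform distribution on `{m, ..., B}`. -/
lemma pmfTail_lt_uniformFrom {B j m : ℕ} {f : ℕ → ℝ} (hf : LatticePMF B f)
    (hmode : IsModeOn B f m) (hm : m < j) (hj : j ≤ B) (hlt : f j < f m) :
    pmfTail B j f < pmfTail B j (uniformFrom B m) := by
  have hm' : (m : ℝ) < j := by exact_mod_cast hm
  have hj' : (j : ℝ) ≤ B := by exact_mod_cast hj
  have htail : pmfTail B j f ≤ ((B : ℝ) + 1 - j) * f j := by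
    have := Finset.sum_le_card_nsmul (Finset.Icc j B) f (f j) fun i hi =>
      hmode.2 j i hm.le (Finset.mem_Icc.mp hi).1 (Finset.mem_Icc.mp hi).2
    simpa [pmfTail, Nat.cast_sub (show j ≤ B + 1 by omega)] using this
  have hmid : ((j : ℝ) - m) * f j < ∑ i ∈ Finset.Ico m j, f i := by
    have : ∑ i ∈ Finset.Ico m j, f j < ∑ i ∈ Finset.Ico m j, f i := by
      refine Finset.sum_lt_sum (fun i hi => ?_) ⟨m, Finset.mem_Ico.mpr ⟨le_rfl, hm⟩, hlt⟩
      rw [Finset.mem_Ico] at hi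
      exact hmode.2 i j hi.1 hi.2.le hj
    simpa [Nat.cast_sub hm.le] using this
  have hsum : ∑ i ∈ Finset.Ico m j, f i + pmfTail B j f ≤ 1 := by
    rw [← hf.2.2, pmfTail, ← Finset.sum_union]
    · refine Finset.sum_le_sum_of_subset_of_nonneg (fun i hi => ?_) fun i _ _ => hf.1 i
      simp only [Finset.mem_union, Finset.mem_Ico, Finset.mem_Icc, Finset.mem_range] at hi ⊢
      omega
    · rw [Finset.disjoint_left]
      intro i hi hi'
      rw [Finset.mem_Ico] at hi
      rw [Finset.mem_Icc] at hi'
      omega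
  rw [pmfTail_uniformFrom hm.le hj, ← div_eq_mul_inv, lt_div_iff₀ (by linarith)]
  have h₁ := mul_le_mul_of_nonneg_left htail (show 0 ≤ (j : ℝ) - m by linarith)
  have h₂ := mul_lt_mul_of_pos_left (show ((j : ℝ) - m) * f j + pmfTail B j f < 1 by linarith)
    (show 0 < (B : ℝ) + 1 - j by linarith)
  linarith

/-- A unimodal pmf whose tail has probability less than one shares a mode with a pmf
with a strictly heavier tail. -/
lemma exists_pmfTail_lt_of_unimodalOn {B j : ℕ} {f : ℕ → ℝ} (hf : LatticePMF B f)
    (hfu : UnimodalOn B f) (hj : j ≤ B) (hT : pmfTail B j f < 1) :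
    ∃ m ≤ B, IsModeOn B f m ∧ ∃ h, LatticePMF B h ∧ IsModeOn B h m ∧
      pmfTail B j f < pmfTail B j h := by
  obtain ⟨m, hm, hmode⟩ := hfu
  change IsModeOn B f m at hmode
  rcases le_or_gt j m with hjm | hmj
  · exact ⟨m, hm, hmode, _, latticePMF_single hm, isModeOn_single B m,
      (pmfTail_single hjm hm).symm ▸ hT⟩
  rcases (hmode.2 m j le_rfl hmj.le hj).lt_or_eq with hlt | heq
  · exact ⟨m, hm, hmode, _, latticePMF_uniformFrom hm, isModeOn_uniformFrom hm,
      pmfTail_lt_uniformFrom hf hmode hmj hj hlt⟩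
  · refine ⟨j, hj, ⟨fun a b hab hb => ?_, fun a b ha => hmode.2 a b (hmj.le.trans ha)⟩, _,
      latticePMF_single hj, isModeOn_single B j, (pmfTail_single le_rfl hj).symm ▸ hT⟩
    rcases le_total b m with hbm | hmb
    · exact hmode.1 a b hab hbm
    · have hjb := hmode.2 b j hmb hb hj
      rcases le_total a m with ham | hma
      · linarith [hmode.1 a m ham le_rfl]
      · linarith [hmode.2 m a le_rfl hma (by omega)]

/-- Proposition 4(i) of Shah & Samworth (2013): any maximiser of the tail
probability `T_t` over the mean-constrained unimodal class `U_η` attains the mean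
constraint with equality. -/
theorem maximiser_mean_eq (B : ℕ) (hB : 1 ≤ B) (η : ℝ) (hη : 0 < η)
    (j : ℕ) (hj1 : 1 ≤ j) (hjB : j ≤ B) (hηt : η < (j : ℝ) / B)
    (f : ℕ → ℝ) (hf : LatticePMF B f) (hfu : UnimodalOn B f) (hfm : pmfMean B f ≤ η)
    (hmax : ∀ g : ℕ → ℝ, LatticePMF B g → UnimodalOn B g → pmfMean B g ≤ η →
      pmfTail B j g ≤ pmfTail B j f) :
    pmfMean B f = η := by
  by_contra hne
  have hlt : pmfMean B f < η := lt_of_le_of_ne hfm hne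
  have ht : 0 < (j : ℝ) / B := hη.trans hηt
  have hT : pmfTail B j f < 1 := by
    by_contra! hT
    have := mul_le_mul_of_nonneg_left hT ht.le
    linarith [hf.mul_pmfTail_le_pmfMean j]
  obtain ⟨m, hm, hmode, h, hh, hhmode, hTh⟩ := exists_pmfTail_lt_of_unimodalOn hf hfu hjB hT
  have ht1 : (j : ℝ) / B ≤ 1 := div_le_one_of_le₀ (by exact_mod_cast hjB) (by positivity)
  have hE0 := hf.pmfMean_nonneg
  have hE1 := hh.pmfMean_le_one
  have hε : 0 < η - pmfMean B f := by linarith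
  have hε1 : η - pmfMean B f ≤ 1 := by linarith
  have key := hmax _ (hf.mix hh hε.le hε1) ⟨m, hm, hmode.mix hhmode hε.le hε1⟩ (by
    rw [pmfMean_mix]
    nlinarith [mul_nonneg hε.le (show 0 ≤ 1 - pmfMean B h + pmfMean B f by linarith)])
  rw [pmfTail_mix] at key
  nlinarith [mul_pos hε (sub_pos.mpr hTh)]
end

section
/- Let B ≥ 1 be an integer, let η ∈ ℝ with η > 0, and let t = j/B for some integer j ∈ {1, ..., B} with η < t. Let U_η be the set of unimodal probability mass functions f on {0, 1, ..., B} with mean E(f) ≤ η, and let T_t(f) = ∑_{i=j}^B f_i. Suppose f* ∈ U_η satisfies T_t(f*) ≥ T_t(g) for all g ∈ U_η, and let i_M = max{i : f*_i > 0}. Then either (a) f*_0 > f*_1, f*_1 = f*_2 = ... = f*_{i_M − 1}, and f*_{i_M − 1} ≥ f*_{i_M}; or (b) i_M = j (i.e. i_M = Bt) and f*_0 = f*_1 = ... = f*_{i_M − 1} ≤ f*_{i_M}. -/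
theorem UnimodalOn.le_of_le_of_le {B : ℕ} {f : ℕ → ℝ} (hf : UnimodalOn B f) {a i b : ℕ}
    (hai : a ≤ i) (hib : i ≤ b) (hb : b ≤ B) {x : ℝ} (ha : x ≤ f a) (hxb : x ≤ f b) :
    x ≤ f i := by
  obtain ⟨m, -, h₁, h₂⟩ := hf
  rcases le_total i m with h | h
  · exact ha.trans (h₁ a i hai h)
  · exact hxb.trans (h₂ i b h hib hb)

theorem Antitone.unimodalOn {B : ℕ} {f : ℕ → ℝ} (hf : Antitone f) : UnimodalOn B f := by
  refine ⟨0, Nat.zero_le _, fun i k hik hk => ?_, fun i k _ hik _ => hf hik⟩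
  obtain rfl : i = k := by omega
  exact le_rfl

theorem sum_range_succ_eq_add_pmfTail {B j : ℕ} (hj : j ≤ B) (f : ℕ → ℝ) :
    ∑ i ∈ Finset.range (B + 1), f i = ∑ i ∈ Finset.range j, f i + pmfTail B j f := by
  have h : Finset.Icc j B = Finset.Ico j (B + 1) := by
    ext i; simp only [Finset.mem_Icc, Finset.mem_Ico]; omega
  rw [pmfTail, h, Finset.range_eq_Ico, Finset.range_eq_Ico,
    Finset.sum_Ico_consecutive f (Nat.zero_le j) (by omega)]

theorem pmfMean_mul {B : ℕ} (hB : 1 ≤ B) (f : ℕ → ℝ) :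
    B * pmfMean B f = ∑ i ∈ Finset.range (B + 1), (i : ℝ) * f i := by
  have hB' : (B : ℝ) ≠ 0 := by positivity
  rw [pmfMean, Finset.mul_sum]
  refine Finset.sum_congr rfl fun i _ => ?_
  field_simp

theorem sum_range_natCast (n : ℕ) : ∑ i ∈ Finset.range n, (i : ℝ) = n * (n - 1) / 2 := by
  induction n with
  | zero => simp
  | succ n ih => rw [Finset.sum_range_succ, ih]; push_cast; ring

/-- A sequence changing sign once, at `r`, from nonpositive to nonnegative has first moment at
least `r` times its sum. -/
theorem mul_sum_le_sum_mul_of_sign_change {n r : ℕ} {h : ℕ → ℝ}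
    (hneg : ∀ i < r, h i ≤ 0) (hpos : ∀ i, r ≤ i → i < n → 0 ≤ h i) :
    r * ∑ i ∈ Finset.range n, h i ≤ ∑ i ∈ Finset.range n, (i : ℝ) * h i ∧
      (∑ i ∈ Finset.range n, (i : ℝ) * h i ≤ r * ∑ i ∈ Finset.range n, h i →
        ∀ i < n, i ≠ r → h i = 0) := by
  have hterm : ∀ i ∈ Finset.range n, 0 ≤ ((i : ℝ) - r) * h i := by
    intro i hi
    rcases lt_or_ge i r with hir | hir
    · have : (i : ℝ) < r := by exact_mod_cast hir
      exact mul_nonneg_of_nonpos_of_nonpos (by linarith) (hneg i hir)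
    · have : (r : ℝ) ≤ i := by exact_mod_cast hir
      exact mul_nonneg (by linarith) (hpos i hir (Finset.mem_range.1 hi))
  have hsum : ∑ i ∈ Finset.range n, ((i : ℝ) - r) * h i =
      ∑ i ∈ Finset.range n, (i : ℝ) * h i - r * ∑ i ∈ Finset.range n, h i := by
    rw [Finset.mul_sum, ← Finset.sum_sub_distrib]
    exact Finset.sum_congr rfl fun i _ => by ring
  have hnonneg := Finset.sum_nonneg hterm
  refine ⟨by linarith, fun hle i hi hir => ?_⟩
  have hzero := (Finset.sum_eq_zero_iff_of_nonneg hterm).1 (by linarith) i (Finset.mem_range.2 hi)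
  have : (i : ℝ) - r ≠ 0 := sub_ne_zero.2 (by exact_mod_cast hir)
  exact (mul_eq_zero.1 hzero).resolve_left this

theorem mul_pmfTail_le {B j : ℕ} {f : ℕ → ℝ} (hf : ∀ i, 0 ≤ f i) :
    j * pmfTail B j f ≤ pmfTail B j (fun i => (i : ℝ) * f i) ∧
      (pmfTail B j (fun i => (i : ℝ) * f i) ≤ j * pmfTail B j f →
        ∀ i, j < i → i ≤ B → f i = 0) := by
  have hterm : ∀ i ∈ Finset.Icc j B, 0 ≤ ((i : ℝ) - j) * f i := by
    intro i hi
    have : (j : ℝ) ≤ i := by exact_mod_cast (Finset.mem_Icc.1 hi).1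
    exact mul_nonneg (by linarith) (hf i)
  have hsum : ∑ i ∈ Finset.Icc j B, ((i : ℝ) - j) * f i =
      pmfTail B j (fun i => (i : ℝ) * f i) - j * pmfTail B j f := by
    rw [pmfTail, pmfTail, Finset.mul_sum, ← Finset.sum_sub_distrib]
    exact Finset.sum_congr rfl fun i _ => by ring
  have hnonneg := Finset.sum_nonneg hterm
  refine ⟨by linarith, fun hle i hji hi => ?_⟩
  have hzero := (Finset.sum_eq_zero_iff_of_nonneg hterm).1 (by linarith) i
    (Finset.mem_Icc.2 ⟨hji.le, hi⟩)
  have : (i : ℝ) - j ≠ 0 := sub_ne_zero.2 (by exact_mod_cast hji.ne')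
  exact (mul_eq_zero.1 hzero).resolve_left this

/-- If the mean constraint is slack, the tail of a nonincreasing pmf with an excess mass at `0`
can be increased. -/
theorem exists_pmfTail_lt_of_antitone {B j : ℕ} (hj : 1 ≤ j) {η : ℝ}
    (hη : 0 < η) {g : ℕ → ℝ} (hg : LatticePMF B g) (hanti : Antitone g) (h10 : g 1 < g 0)
    (hmean : pmfMean B g < η) (htail : 0 < pmfTail B j g) :
    ∃ h, LatticePMF B h ∧ UnimodalOn B h ∧ pmfMean B h ≤ η ∧ pmfTail B j g < pmfTail B j h := by
  obtain ⟨hg0, hgB, hg1⟩ := hg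
  obtain ⟨ε, hε, hε₁, hε₂⟩ : ∃ ε : ℝ, 0 < ε ∧ ε ≤ g 0 - g 1 ∧ ε * η ≤ η - pmfMean B g := by
    refine ⟨min (g 0 - g 1) ((η - pmfMean B g) / η),
      lt_min (by linarith) (div_pos (by linarith) hη), min_le_left _ _, ?_⟩
    exact (le_div_iff₀ hη).1 (min_le_right _ _)
  set h : ℕ → ℝ := fun i => (1 + ε) * g i - if i = 0 then ε else 0 with hh
  have hsucc : ∀ n, h (n + 1) = (1 + ε) * g (n + 1) := fun n => by simp [hh]
  have hzero : h 0 = (1 + ε) * g 0 - ε := by simp [hh]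
  have hanti' : Antitone h := by
    refine antitone_nat_of_succ_le fun n => ?_
    cases n with
    | zero => rw [hsucc, hzero]; nlinarith [hg0 1]
    | succ n =>
      rw [hsucc, hsucc]
      exact mul_le_mul_of_nonneg_left (hanti (Nat.le_succ _)) (by linarith)
  have hhB : ∀ i, B < i → h i = 0 := by
    intro i hi
    obtain ⟨n, rfl⟩ : ∃ n, i = n + 1 := ⟨i - 1, by omega⟩
    rw [hsucc, hgB _ hi, mul_zero]
  refine ⟨h, ⟨fun i => ?_, hhB, ?_⟩, hanti'.unimodalOn, ?_, ?_⟩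
  · rw [← hhB (max i B + 1) (by omega)]
    exact hanti' (by omega)
  · rw [hh, Finset.sum_sub_distrib, ← Finset.mul_sum, hg1]
    simp
  · have : pmfMean B h = (1 + ε) * pmfMean B g := by
      rw [pmfMean, pmfMean, Finset.mul_sum]
      refine Finset.sum_congr rfl fun i _ => ?_
      cases i with
      | zero => simp
      | succ n => rw [hsucc]; ring
    rw [this]
    nlinarith
  · have : pmfTail B j h = (1 + ε) * pmfTail B j g := by
      rw [pmfTail, pmfTail, Finset.mul_sum]
      refine Finset.sum_congr rfl fun i hi => ?_
      obtain ⟨n, rfl⟩ : ∃ n, i = n + 1 := ⟨i - 1, by have := (Finset.mem_Icc.1 hi).1; omega⟩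
      rw [hsucc]
    rw [this]
    nlinarith

theorem exists_pmfTail_pos {B j : ℕ} (hj : 1 ≤ j) (hjB : j ≤ B) {η : ℝ} (hη : 0 < η) :
    ∃ h, LatticePMF B h ∧ UnimodalOn B h ∧ pmfMean B h ≤ η ∧ 0 < pmfTail B j h := by
  have hB : (0 : ℝ) < B := by exact_mod_cast hj.trans hjB
  obtain ⟨ε, hε, hε₁, hε₂⟩ : ∃ ε : ℝ, 0 < ε ∧ ε * (B + 1) ≤ 1 ∧ ε * (B + 1) ≤ η := by
    refine ⟨min (1 / (B + 1)) (η / (B + 1)), by positivity, ?_, ?_⟩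
    · exact (le_div_iff₀ (by positivity)).1 (min_le_left _ _)
    · exact (le_div_iff₀ (by positivity)).1 (min_le_right _ _)
  set h : ℕ → ℝ := fun i => (if i ≤ B then ε else 0) + if i = 0 then 1 - ε * (B + 1) else 0 with hh
  have hanti : Antitone h := by
    refine antitone_nat_of_succ_le fun n => ?_
    simp only [hh, if_neg n.succ_ne_zero]
    split_ifs <;> first | omega | linarith
  have hle : ∀ i ∈ Finset.range (B + 1), h i = ε + if i = 0 then 1 - ε * (B + 1) else 0 := by
    intro i hi
    simp [hh, Nat.lt_succ_iff.1 (Finset.mem_range.1 hi)]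
  refine ⟨h, ⟨fun i => ?_, fun i hi => ?_, ?_⟩, hanti.unimodalOn, ?_, ?_⟩
  · simp only [hh]
    split_ifs <;> linarith
  · simp [hh, hi.not_ge, (Nat.zero_le B |>.trans_lt hi).ne']
  · rw [Finset.sum_congr rfl hle, Finset.sum_add_distrib]
    simp
    ring
  · refine le_trans ?_ hε₂
    have : ε * (B + 1) = ∑ _i ∈ Finset.range (B + 1), ε := by simp; ring
    rw [this, pmfMean]
    refine Finset.sum_le_sum fun i hi => ?_
    rw [hle i hi]
    rcases Nat.eq_zero_or_pos i with rfl | hi0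
    · simpa using hε.le
    · rw [if_neg hi0.ne', add_zero]
      have : (i : ℝ) ≤ B := by exact_mod_cast Nat.lt_succ_iff.1 (Finset.mem_range.1 hi)
      exact mul_le_of_le_one_left hε.le ((div_le_one hB).2 this)
  · refine Finset.sum_pos (fun i hi => ?_) ⟨j, Finset.mem_Icc.2 ⟨le_rfl, hjB⟩⟩
    simp only [Finset.mem_Icc] at hi
    simp [hh, hi.2, show i ≠ 0 by omega, hε]

/-- The pmf with mass `τ` at `j` and the rest spread evenly over `{0, ..., j - 1}`. -/
theorem exists_flat_below {B j : ℕ} (hj : 1 ≤ j) (hjB : j ≤ B) {τ : ℝ} (hτ1 : τ ≤ 1)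
    (hτ : 1 - τ ≤ j * τ) :
    ∃ h, LatticePMF B h ∧ UnimodalOn B h ∧
      B * pmfMean B h = (1 - τ) * (j - 1) / 2 + j * τ ∧ pmfTail B j h = τ := by
  have hj0 : (0 : ℝ) < j := by exact_mod_cast hj
  have hτ0 : 0 ≤ τ := by nlinarith
  set h : ℕ → ℝ := fun i => if i < j then (1 - τ) / j else if i = j then τ else 0 with hh
  have hd : (1 - τ) / j ≤ τ := (div_le_iff₀ hj0).2 (by linarith)
  have hd0 : 0 ≤ (1 - τ) / j := div_nonneg (by linarith) hj0.le
  have hlt : ∀ i ∈ Finset.range j, h i = (1 - τ) / j := fun i hi => by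
    simp [hh, Finset.mem_range.1 hi]
  have hge : ∀ i ∈ Finset.Icc j B, h i = if i = j then τ else 0 := fun i hi => by
    simp [hh, (Finset.mem_Icc.1 hi).1]
  have htail : pmfTail B j h = τ := by
    rw [pmfTail, Finset.sum_congr rfl hge]
    simp [hjB]
  refine ⟨h, ⟨fun i => ?_, fun i hi => ?_, ?_⟩, ⟨j, hjB, ?_, ?_⟩, ?_, htail⟩
  · simp only [hh]; split_ifs <;> linarith
  · simp [hh, show ¬ i < j by omega, show i ≠ j by omega]
  · rw [sum_range_succ_eq_add_pmfTail hjB, htail, Finset.sum_congr rfl hlt]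
    simp
    field_simp
    ring
  · intro i k hik hkj
    simp only [hh]
    split_ifs <;> first | omega | linarith
  · intro i k hji hik _
    simp only [hh]
    split_ifs <;> first | omega | linarith
  · rw [pmfMean_mul (hj.trans hjB), sum_range_succ_eq_add_pmfTail hjB]
    have h₁ : ∑ i ∈ Finset.range j, (i : ℝ) * h i = (1 - τ) * (j - 1) / 2 := by
      rw [Finset.sum_congr rfl fun i hi => by rw [hlt i hi], ← Finset.sum_mul, sum_range_natCast]
      field_simp
    have h₂ : pmfTail B j (fun i => (i : ℝ) * h i) = j * τ := by
      rw [pmfTail, Finset.sum_congr rfl fun i hi => by rw [hge i hi]]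
      simp [hjB]
    rw [h₁, h₂]

/-- Among unimodal pmfs whose mass at `j` is at least the average mass below `j`, the flat ones
minimise the mean for a given tail, and are the only ones to do so. -/
theorem flat_mean_le {B j : ℕ} (hj : 1 ≤ j) (hjB : j ≤ B) {f : ℕ → ℝ} (hf : LatticePMF B f)
    (hfu : UnimodalOn B f) (hd : 1 - pmfTail B j f ≤ j * f j) :
    (1 - pmfTail B j f) * (j - 1) / 2 + j * pmfTail B j f ≤ B * pmfMean B f ∧
      (B * pmfMean B f ≤ (1 - pmfTail B j f) * (j - 1) / 2 + j * pmfTail B j f →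
        (∀ i < j, j * f i = 1 - pmfTail B j f) ∧ ∀ i, j < i → f i = 0) := by
  obtain ⟨hf0, hfB, hf1⟩ := hf
  have hj0 : (0 : ℝ) < j := by exact_mod_cast hj
  set T := pmfTail B j f
  have hhead : ∑ i ∈ Finset.range j, f i = 1 - T := by
    rw [sum_range_succ_eq_add_pmfTail hjB] at hf1; linarith
  set d := (1 - T) / j with hdd
  have hdj : j * d = 1 - T := by rw [hdd]; field_simp
  have hdfj : d ≤ f j := le_of_mul_le_mul_left (by linarith) hj0
  have hlast : d ≤ f (j - 1) := by
    have hfu' := hfu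
    obtain ⟨m, hm, h₁, h₂⟩ := hfu'
    rcases lt_or_ge (j - 1) m with h | h
    · have : ∑ i ∈ Finset.range j, f i ≤ ∑ i ∈ Finset.range j, f (j - 1) :=
        Finset.sum_le_sum fun i hi => h₁ i (j - 1) (by have := Finset.mem_range.1 hi; omega) h.le
      rw [Finset.sum_const, Finset.card_range, nsmul_eq_mul] at this
      exact le_of_mul_le_mul_left (by linarith) hj0
    · exact hdfj.trans (h₂ (j - 1) j h (by omega) hjB)
  classical
  have hex : ∃ r, d ≤ f r := ⟨_, hlast⟩
  have hr : Nat.find hex ≤ j - 1 := Nat.find_min' hex hlast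
  have hcross := mul_sum_le_sum_mul_of_sign_change (n := j) (r := Nat.find hex)
    (h := fun i => f i - d)
    (fun i hi => by have := Nat.find_min hex hi; push Not at this; linarith)
    (fun i hi hij => sub_nonneg.2 (hfu.le_of_le_of_le hi (by omega) (by omega)
      (Nat.find_spec hex) hlast))
  have hsum0 : ∑ i ∈ Finset.range j, (f i - d) = 0 := by
    rw [Finset.sum_sub_distrib, hhead]; simp [hdj]
  have hmom : ∑ i ∈ Finset.range j, (i : ℝ) * (f i - d) =
      ∑ i ∈ Finset.range j, (i : ℝ) * f i - (1 - T) * (j - 1) / 2 := by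
    simp only [mul_sub, Finset.sum_sub_distrib, ← Finset.sum_mul, sum_range_natCast]
    rw [← hdj]; ring
  rw [hsum0, mul_zero, hmom] at hcross
  have htail := mul_pmfTail_le (B := B) (j := j) hf0
  rw [pmfMean_mul (hj.trans hjB), sum_range_succ_eq_add_pmfTail hjB (fun i => (i : ℝ) * f i)]
  refine ⟨by linarith [hcross.1, htail.1], fun hle => ⟨fun i hi => ?_, fun i hi => ?_⟩⟩
  · have hne := hcross.2 (by linarith [htail.1])
    suffices f i - d = 0 by rw [← hdj, sub_eq_zero.1 this]
    by_cases hir : i = Nat.find hex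
    · rw [← hsum0]
      exact (Finset.sum_eq_single_of_mem i (Finset.mem_range.2 hi) fun k hk hki =>
        hne k (Finset.mem_range.1 hk) (by rwa [← hir])).symm
    · exact hne i hi hir
  · rcases le_or_gt i B with hiB | hiB
    · exact htail.2 (by linarith [hcross.1]) i hi hiB
    · exact hfB i hiB

/-- If the mass at `j` is below the average mass below `j`, then levelling `f` to `f j` on
`{1, ..., j - 1}` keeps the tail and reduces the mean, strictly unless nothing changes. -/
theorem exists_levelled {B j : ℕ} (hj : 1 ≤ j) (hjB : j ≤ B) {f : ℕ → ℝ} (hf : LatticePMF B f)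
    (hfu : UnimodalOn B f) (hd : j * f j < 1 - pmfTail B j f) :
    ∃ g, LatticePMF B g ∧ Antitone g ∧ g 1 < g 0 ∧ pmfTail B j g = pmfTail B j f ∧
      pmfMean B g ≤ pmfMean B f ∧ (pmfMean B f ≤ pmfMean B g → f = g) ∧
      ∀ i, 1 ≤ i → i ≤ j → g i = f j := by
  obtain ⟨hf0, hfB, hf1⟩ := hf
  have hj0 : (0 : ℝ) < j := by exact_mod_cast hj
  have hB0 : (0 : ℝ) < B := by exact_mod_cast hj.trans hjB
  set T := pmfTail B j f
  set c := f j
  have hhead : ∑ i ∈ Finset.range j, f i = 1 - T := by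
    rw [sum_range_succ_eq_add_pmfTail hjB] at hf1; linarith
  have hanti : ∀ i k, j ≤ i → i ≤ k → k ≤ B → f k ≤ f i := by
    have hfu' := hfu
    obtain ⟨m, hm, h₁, h₂⟩ := hfu'
    rcases lt_or_ge m j with h | h
    · exact fun i k hi hik hk => h₂ i k (by omega) hik hk
    · have : ∑ i ∈ Finset.range j, f i ≤ ∑ i ∈ Finset.range j, c :=
        Finset.sum_le_sum fun i hi => h₁ i j (Finset.mem_range.1 hi).le h
      rw [Finset.sum_const, Finset.card_range, nsmul_eq_mul] at this
      linarith
  set g : ℕ → ℝ := fun i => (if i < j then c else f i) + if i = 0 then 1 - T - j * c else 0 with hg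
  have hlt : ∀ i ∈ Finset.range j, g i = c + if i = 0 then 1 - T - j * c else 0 := fun i hi => by
    simp [hg, Finset.mem_range.1 hi]
  have hge : ∀ i, j ≤ i → g i = f i := fun i hi => by
    simp [hg, hi.not_gt, show i ≠ 0 by omega]
  have hlevel : ∀ i, 1 ≤ i → i ≤ j → g i = c := by
    intro i hi hij
    rcases hij.lt_or_eq with h | rfl
    · simp [hg, h, show i ≠ 0 by omega]
    · exact hge _ le_rfl
  have hg00 : g 0 = c + (1 - T - j * c) := by simp [hg, show 0 < j by omega]
  have htail : pmfTail B j g = T :=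
    Finset.sum_congr rfl fun i hi => hge i (Finset.mem_Icc.1 hi).1
  have hghead : ∑ i ∈ Finset.range j, g i = 1 - T := by
    rw [Finset.sum_congr rfl hlt, Finset.sum_add_distrib]
    simp [show 0 < j by omega]
  have h10 : g 1 < g 0 := by rw [hlevel 1 le_rfl hj, hg00]; linarith
  have hganti : Antitone g := by
    refine antitone_nat_of_succ_le fun n => ?_
    rcases Nat.eq_zero_or_pos n with rfl | hn
    · exact h10.le
    · rcases lt_or_ge n j with h | h
      · rw [hlevel n hn h.le, hlevel (n + 1) (by omega) h]
      · rw [hge n h, hge (n + 1) (by omega)]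
        rcases le_or_gt (n + 1) B with h' | h'
        · exact hanti n (n + 1) h (by omega) h'
        · rw [hfB _ h']; exact hf0 n
  have hgpmf : LatticePMF B g := by
    refine ⟨fun i => ?_, fun i hi => ?_, ?_⟩
    · rcases Nat.eq_zero_or_pos i with rfl | hi
      · rw [hg00]; linarith [hf0 j]
      · rcases lt_or_ge i j with h | h
        · rw [hlevel i hi h.le]; exact hf0 j
        · rw [hge i h]; exact hf0 i
    · rw [hge i (by omega), hfB i hi]
    · rw [sum_range_succ_eq_add_pmfTail hjB, htail, hghead]; ring
  classical
  have hex : ∃ r, c ≤ f r := ⟨j, le_rfl⟩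
  have hcross := mul_sum_le_sum_mul_of_sign_change (n := j) (r := Nat.find hex)
    (h := fun i => f i - c)
    (fun i hi => by have := Nat.find_min hex hi; push Not at this; linarith)
    (fun i hi hij => sub_nonneg.2 (hfu.le_of_le_of_le hi hij.le hjB (Nat.find_spec hex) le_rfl))
  have hsum : ∑ i ∈ Finset.range j, (f i - c) = 1 - T - j * c := by
    rw [Finset.sum_sub_distrib, hhead]; simp
  have hmom : ∑ i ∈ Finset.range j, (i : ℝ) * (f i - c) = B * pmfMean B f - B * pmfMean B g := by
    rw [pmfMean_mul (hj.trans hjB), pmfMean_mul (hj.trans hjB),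
      sum_range_succ_eq_add_pmfTail hjB, sum_range_succ_eq_add_pmfTail hjB]
    have h₁ : pmfTail B j (fun i => (i : ℝ) * g i) = pmfTail B j (fun i => (i : ℝ) * f i) :=
      Finset.sum_congr rfl fun i hi => congrArg _ (hge i (Finset.mem_Icc.1 hi).1)
    rw [h₁, add_sub_add_right_eq_sub, ← Finset.sum_sub_distrib]
    refine Finset.sum_congr rfl fun i hi => ?_
    rcases Nat.eq_zero_or_pos i with rfl | hi0
    · simp
    · rw [hlevel i hi0 (Finset.mem_range.1 hi).le]; ring
  rw [hsum, hmom] at hcross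
  have hr0 : (0 : ℝ) ≤ (Nat.find hex : ℝ) * (1 - T - j * c) :=
    mul_nonneg (Nat.cast_nonneg _) (by linarith)
  refine ⟨g, hgpmf, hganti, h10, htail,
    le_of_mul_le_mul_left (by linarith [hcross.1]) hB0, fun hle => ?_, hlevel⟩
  have hle' : B * pmfMean B f ≤ B * pmfMean B g := mul_le_mul_of_nonneg_left hle hB0.le
  have hr : Nat.find hex = 0 := by
    by_contra hne
    have : (0 : ℝ) < Nat.find hex := by exact_mod_cast Nat.pos_of_ne_zero hne
    nlinarith [hcross.1]
  have hpos : ∀ i, i ≠ 0 → f i = g i := by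
    intro i hi
    rcases lt_or_ge i j with h | h
    · rw [hlevel i (by omega) h.le]
      exact sub_eq_zero.1 (hcross.2 (by linarith) i h (by rwa [hr]))
    · exact (hge i h).symm
  funext i
  rcases eq_or_ne i 0 with rfl | hi
  · have h := hhead.trans hghead.symm
    obtain ⟨n, rfl⟩ : ∃ n, j = n + 1 := ⟨j - 1, by omega⟩
    rw [Finset.sum_range_succ', Finset.sum_range_succ',
      Finset.sum_congr rfl fun i _ => hpos (i + 1) (by omega)] at h
    linarith
  · exact hpos i hi

/-- Moving mass from the last support point to an earlier tail point where a nonincreasing pmf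
drops below its preceding value keeps the tail and strictly reduces the mean. -/
theorem exists_pmfMean_lt_of_drop {B j k l : ℕ} (hj : 1 ≤ j) (hjk : j < k) (hkl : k < l)
    {f : ℕ → ℝ} (hf : LatticePMF B f) (hanti : Antitone f) (h10 : f 1 < f 0)
    (hdrop : f k < f (k - 1)) (hl : 0 < f l) (hlast : f (l + 1) = 0) :
    ∃ g, LatticePMF B g ∧ Antitone g ∧ g 1 < g 0 ∧ pmfTail B j g = pmfTail B j f ∧
      pmfMean B g < pmfMean B f := by
  obtain ⟨hf0, hfB, hf1⟩ := hf
  have hlB : l ≤ B := by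
    by_contra! h
    exact hl.ne' (hfB l h)
  have hB0 : (0 : ℝ) < B := by exact_mod_cast (by omega : 0 < B)
  obtain ⟨ε, hε, hε₁, hε₂⟩ : ∃ ε : ℝ, 0 < ε ∧ ε ≤ f (k - 1) - f k ∧ ε ≤ f l :=
    ⟨_, lt_min (sub_pos.2 hdrop) hl, min_le_left _ _, min_le_right _ _⟩
  set g : ℕ → ℝ := fun i => f i + ((if i = k then ε else 0) - if i = l then ε else 0) with hg
  have hsum : ∀ (s : Finset ℕ) (w : ℕ → ℝ), k ∈ s → l ∈ s →
      ∑ i ∈ s, w i * g i = ∑ i ∈ s, w i * f i + (w k * ε - w l * ε) := by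
    intro s w hk hl
    simp [hg, mul_add, mul_sub, Finset.sum_add_distrib, Finset.sum_sub_distrib, hk, hl]
  have hkr : k ∈ Finset.range (B + 1) := Finset.mem_range.2 (by omega)
  have hlr : l ∈ Finset.range (B + 1) := Finset.mem_range.2 (by omega)
  refine ⟨g, ⟨fun i => ?_, fun i hi => ?_, ?_⟩, antitone_nat_of_succ_le fun n => ?_, ?_, ?_, ?_⟩
  · by_cases h : i = l
    · subst h; simp [hg, hkl.ne', hε₂]
    · simp only [hg, if_neg h]
      have := hf0 i
      split_ifs <;> linarith
  · simp [hg, hfB i hi, show i ≠ k by omega, show i ≠ l by omega]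
  · simpa [hf1] using hsum _ (fun _ => 1) hkr hlr
  · have hn := hanti (Nat.le_succ n)
    simp only [Nat.succ_eq_add_one] at hn
    by_cases h₁ : n + 1 = k
    · have : n = k - 1 := by omega
      subst this
      simp only [hg, h₁, if_true, if_neg hkl.ne, if_neg (show k - 1 ≠ k by omega),
        if_neg (show k - 1 ≠ l by omega)]
      linarith
    · by_cases h₂ : n = l
      · subst h₂
        simp only [hg, hlast, if_true, if_neg h₁, if_neg hkl.ne', if_neg (show n + 1 ≠ n by omega)]
        linarith
      · simp only [hg, if_neg h₁, if_neg h₂]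
        split_ifs <;> linarith
  · simpa [hg, show 1 ≠ k by omega, show 1 ≠ l by omega, show 0 ≠ k by omega,
      show 0 ≠ l by omega] using h10
  · simpa [pmfTail] using hsum (Finset.Icc j B) (fun _ => 1)
      (Finset.mem_Icc.2 ⟨by omega, by omega⟩) (Finset.mem_Icc.2 ⟨by omega, hlB⟩)
  · rw [pmfMean, hsum _ _ hkr hlr, pmfMean]
    have : (k : ℝ) / B < l / B := div_lt_div_of_pos_right (by exact_mod_cast hkl) hB0
    nlinarith

/-- Proposition 4(ii) of Shah & Samworth (2013): a maximiser `f` of the tail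
probability over the mean-constrained unimodal class has one of two shapes; with
`iM` the largest support point, either
(a) `f_0 > f_1 = f_2 = ... = f_{iM-1} ≥ f_{iM}`, or
(b) `iM = j` and `f_0 = f_1 = ... = f_{iM-1} ≤ f_{iM}`. -/
theorem maximiser_shape (B : ℕ) (hB : 1 ≤ B) (η : ℝ) (hη : 0 < η)
    (j : ℕ) (hj1 : 1 ≤ j) (hjB : j ≤ B) (hηt : η < (j : ℝ) / B)
    (f : ℕ → ℝ) (hf : LatticePMF B f) (hfu : UnimodalOn B f) (hfm : pmfMean B f ≤ η)
    (hmax : ∀ g : ℕ → ℝ, LatticePMF B g → UnimodalOn B g → pmfMean B g ≤ η →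
      pmfTail B j g ≤ pmfTail B j f)
    (iM : ℕ) (hiMpos : 0 < f iM) (hiMmax : ∀ i, 0 < f i → i ≤ iM) :
    (f 1 < f 0 ∧ (∀ i, 1 ≤ i → i ≤ iM - 1 → f i = f 1) ∧ f iM ≤ f (iM - 1)) ∨
    (iM = j ∧ (∀ i, i ≤ iM - 1 → f i = f 0) ∧ f (iM - 1) ≤ f iM) := by
  have hB0 : (0 : ℝ) < B := by exact_mod_cast hB
  have hj0 : (0 : ℝ) < j := by exact_mod_cast hj1
  have hT0 : 0 < pmfTail B j f := by
    obtain ⟨h, h₁, h₂, h₃, h₄⟩ := exists_pmfTail_pos hj1 hjB hη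
    exact h₄.trans_le (hmax h h₁ h₂ h₃)
  have hjiM : j ≤ iM := by
    obtain ⟨i, hi, hfi⟩ : ∃ i ∈ Finset.Icc j B, 0 < f i := by
      by_contra! h
      exact hT0.not_ge (Finset.sum_nonpos h)
    exact (Finset.mem_Icc.1 hi).1.trans (hiMmax i hfi)
  have hηB : η * B < j := (lt_div_iff₀ hB0).1 hηt
  have hfmB : B * pmfMean B f ≤ η * B := by nlinarith
  rcases le_or_gt (1 - pmfTail B j f) (j * f j) with hd | hd
  · right
    obtain ⟨hle, heq⟩ := flat_mean_le hj1 hjB hf hfu hd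
    set T := pmfTail B j f with hT
    have hfjT : f j ≤ T := Finset.single_le_sum (fun i _ => hf.1 i)
      (Finset.mem_Icc.2 ⟨le_rfl, hjB⟩)
    have hT1 : T < 1 := by nlinarith
    have hge : B * pmfMean B f ≤ (1 - T) * (j - 1) / 2 + j * T := by
      by_contra! hlt
      obtain ⟨δ, hδ, hδ₁, hδ₂⟩ : ∃ δ : ℝ, 0 < δ ∧ δ ≤ 1 - T ∧
          δ * ((j + 1) / 2) ≤ η * B - ((1 - T) * (j - 1) / 2 + j * T) := by
        refine ⟨min (1 - T) ((η * B - ((1 - T) * (j - 1) / 2 + j * T)) / ((j + 1) / 2)),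
          lt_min (by linarith) (div_pos (by linarith) (by positivity)), min_le_left _ _, ?_⟩
        exact (le_div_iff₀ (by positivity)).1 (min_le_right _ _)
      obtain ⟨h, h₁, h₂, h₃, h₄⟩ := exists_flat_below hj1 hjB (τ := T + δ) (by linarith)
        (by nlinarith)
      have := hmax h h₁ h₂ (le_of_mul_le_mul_left (by rw [h₃]; nlinarith) hB0)
      linarith
    obtain ⟨hflat, hzero⟩ := heq hge
    have hij : iM = j := by
      by_contra hne
      exact hiMpos.ne' (hzero iM (by omega))
    refine ⟨hij, fun i hi => ?_, ?_⟩
    · exact mul_left_cancel₀ hj0.ne' ((hflat i (by omega)).trans (hflat 0 (by omega)).symm)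
    · rw [hij]
      exact le_of_mul_le_mul_left ((hflat (j - 1) (by omega)).trans_le hd) hj0
  · left
    have hopt : ∀ g, LatticePMF B g → Antitone g → g 1 < g 0 → pmfTail B j g = pmfTail B j f →
        pmfMean B f ≤ pmfMean B g := by
      intro g hg hanti h10 htail
      by_contra! hlt
      obtain ⟨h, h₁, h₂, h₃, h₄⟩ := exists_pmfTail_lt_of_antitone hj1 hη hg hanti h10
        (hlt.trans_le hfm) (htail ▸ hT0)
      exact absurd (hmax h h₁ h₂ h₃) (by linarith)
    obtain ⟨g, hg, hanti, h10, htail, -, heq, hlevel⟩ := exists_levelled hj1 hjB hf hfu hd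
    obtain rfl := heq (hopt g hg hanti h10 htail)
    refine ⟨h10, fun i hi hi' => ?_, hanti (Nat.sub_le _ _)⟩
    by_contra hne
    have hilt : f i < f 1 := lt_of_le_of_ne (hanti hi) hne
    classical
    have hex : ∃ k, f k < f 1 := ⟨i, hilt⟩
    have hjk : j < Nat.find hex := by
      by_contra! hle
      have hspec := Nat.find_spec hex
      rcases Nat.eq_zero_or_pos (Nat.find hex) with h | h
      · rw [h] at hspec; linarith
      · rw [hlevel _ h hle, hlevel 1 le_rfl hj1] at hspec; exact lt_irrefl _ hspec
    have hki : Nat.find hex ≤ i := Nat.find_min' hex hilt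
    have hprev : f 1 ≤ f (Nat.find hex - 1) :=
      not_lt.1 (Nat.find_min hex (by omega : Nat.find hex - 1 < Nat.find hex))
    have hlast : f (iM + 1) = 0 := le_antisymm
      (not_lt.1 fun h => absurd (hiMmax _ h) (by omega)) (hf.1 _)
    obtain ⟨g, h₁, h₂, h₃, h₄, h₅⟩ := exists_pmfMean_lt_of_drop hj1 hjk
      (by omega : Nat.find hex < iM) hf hanti h10
      ((Nat.find_spec hex).trans_le hprev) hiMpos hlast
    exact absurd (hopt g h₁ h₂ h₃ h₄) h₅.not_ge
end

section
/- Let B ≥ 1 be an integer, let r < 0, let η ∈ ℝ with η > 0, and let t = j/B for some integer j ∈ {1, ..., B} with η < t. Let F_{r,η} be the set of r-concave probability mass functions f on {0, 1, ..., B} with mean E(f) ≤ η, and let T_t(f) = ∑_{i=j}^B f_i. If f* ∈ F_{r,η} satisfies T_t(f*) ≥ T_t(g) for all g ∈ F_{r,η}, then E(f*) = η. -/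
/-- For `r < 0`, a pmf `f` on `{0, 1, ..., B}` is `r`-concave if for all
`i ≤ j' ≤ k ≤ B` with `f_i > 0` and `f_k > 0`, also `f_{j'} > 0` and
`(k - i) f_{j'}^r ≤ (k - j') f_i^r + (j' - i) f_k^r` (convexity of the linear
interpolant of `f^r`, with the convention `0^r = ∞`). -/
def RConcavePMF (B : ℕ) (r : ℝ) (f : ℕ → ℝ) : Prop :=
  ∀ i j' k : ℕ, i ≤ j' → j' ≤ k → k ≤ B → 0 < f i → 0 < f k →
    0 < f j' ∧
      ((k : ℝ) - i) * f j' ^ r ≤ ((k : ℝ) - j') * f i ^ r + ((j' : ℝ) - i) * f k ^ r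

open Filter Topology Finset

/-- The function whose `r`-th power is the `r`-th power of `f` plus the affine function
`i ↦ c * i + d`, on the support of `f`. -/
noncomputable def affinePerturb (r : ℝ) (f : ℕ → ℝ) (c d : ℝ) (i : ℕ) : ℝ :=
  if 0 < f i then (f i ^ r + (c * i + d)) ^ r⁻¹ else 0

lemma affinePerturb_of_pos {r : ℝ} {f : ℕ → ℝ} (c d : ℝ) {i : ℕ} (hi : 0 < f i) :
    affinePerturb r f c d i = (f i ^ r + (c * i + d)) ^ r⁻¹ := if_pos hi

lemma affinePerturb_of_not_pos {r : ℝ} {f : ℕ → ℝ} (c d : ℝ) {i : ℕ} (hi : ¬ 0 < f i) :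
    affinePerturb r f c d i = 0 := if_neg hi

lemma pos_of_affinePerturb_pos {r : ℝ} {f : ℕ → ℝ} {c d : ℝ} {i : ℕ}
    (h : 0 < affinePerturb r f c d i) : 0 < f i := by
  by_contra hi
  exact h.ne' (affinePerturb_of_not_pos c d hi)

lemma RConcavePMF.add_affine {B : ℕ} {r : ℝ} (hr : r < 0) {f : ℕ → ℝ}
    (hf : RConcavePMF B r f) {c d : ℝ}
    (hpos : ∀ i ≤ B, 0 < f i → 0 < f i ^ r + (c * i + d)) :
    RConcavePMF B r (affinePerturb r f c d) := by
  intro i m k him hmk hk hi hk0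
  have hi := pos_of_affinePerturb_pos hi
  have hk0 := pos_of_affinePerturb_pos hk0
  obtain ⟨hm, hle⟩ := hf i m k him hmk hk hi hk0
  have pi := hpos i (by omega) hi
  have pm := hpos m (by omega) hm
  have pk := hpos k hk hk0
  rw [affinePerturb_of_pos c d hi, affinePerturb_of_pos c d hm, affinePerturb_of_pos c d hk0,
    Real.rpow_inv_rpow pi.le hr.ne, Real.rpow_inv_rpow pm.le hr.ne,
    Real.rpow_inv_rpow pk.le hr.ne]
  exact ⟨Real.rpow_pos_of_pos pm _, by linarith⟩

lemma affinePerturb_nonneg {B : ℕ} {r : ℝ} {f : ℕ → ℝ} {c d : ℝ}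
    (hB : ∀ i, B < i → f i = 0)
    (hpos : ∀ i ≤ B, 0 < f i → 0 < f i ^ r + (c * i + d)) (i : ℕ) :
    0 ≤ affinePerturb r f c d i := by
  by_cases hi : 0 < f i
  · rw [affinePerturb_of_pos c d hi]
    have : i ≤ B := by
      by_contra h
      exact hi.ne' (hB i (by omega))
    exact (Real.rpow_pos_of_pos (hpos i this hi) _).le
  · rw [affinePerturb_of_not_pos c d hi]

lemma RConcavePMF.div_const {B : ℕ} {r : ℝ} {u : ℕ → ℝ} (hu : RConcavePMF B r u)
    (hu0 : ∀ i, 0 ≤ u i) {s : ℝ} (hs : 0 < s) : RConcavePMF B r (fun i => u i / s) := by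
  intro i m k him hmk hk hi hk0
  have hi : 0 < u i := (div_pos_iff_of_pos_right hs).1 hi
  have hk0 : 0 < u k := (div_pos_iff_of_pos_right hs).1 hk0
  obtain ⟨hm, hle⟩ := hu i m k him hmk hk hi hk0
  refine ⟨div_pos hm hs, ?_⟩
  simp only [Real.div_rpow (hu0 _) hs.le]
  have := div_le_div_of_nonneg_right hle (Real.rpow_pos_of_pos hs r).le
  calc _ = ((k : ℝ) - i) * u m ^ r / s ^ r := by ring
    _ ≤ _ := this
    _ = _ := by ring

/-- The maximality of the tail probability, expressed for unnormalised competitors. -/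
lemma pmfTail_le_of_maximiser {B : ℕ} {r η : ℝ} {j : ℕ} {f : ℕ → ℝ}
    (hmax : ∀ g : ℕ → ℝ, LatticePMF B g → RConcavePMF B r g → pmfMean B g ≤ η →
      pmfTail B j g ≤ pmfTail B j f)
    {u : ℕ → ℝ} (hu0 : ∀ i, 0 ≤ u i) (huB : ∀ i, B < i → u i = 0)
    (hus : 0 < ∑ i ∈ range (B + 1), u i) (hur : RConcavePMF B r u)
    (hum : pmfMean B u ≤ η * ∑ i ∈ range (B + 1), u i) :
    pmfTail B j u ≤ pmfTail B j f * ∑ i ∈ range (B + 1), u i := by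
  set s := ∑ i ∈ range (B + 1), u i with hs
  have h := hmax (fun i => u i / s)
    ⟨fun i => div_nonneg (hu0 i) hus.le, fun i hi => by simp [huB i hi],
      by rw [← sum_div, ← hs, div_self hus.ne']⟩
    (hur.div_const hu0 hus) (by
      have : pmfMean B (fun i => u i / s) = pmfMean B u / s := by
        simp only [pmfMean, sum_div, mul_div_assoc]
      rw [this]
      exact (div_le_iff₀ hus).2 hum)
  have ht : pmfTail B j (fun i => u i / s) = pmfTail B j u / s := by
    simp only [pmfTail, sum_div]
  rw [ht] at h
  exact (div_le_iff₀ hus).1 h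

lemma sum_range_add_pmfTail {B j : ℕ} (hjB : j ≤ B) (u : ℕ → ℝ) :
    ∑ i ∈ range j, u i + pmfTail B j u = ∑ i ∈ range (B + 1), u i := by
  rw [pmfTail, ← Finset.Ico_add_one_right_eq_Icc]
  exact sum_range_add_sum_Ico u (by omega)

/-- There are `r`-concave weights with positive tail and arbitrarily small mean. -/
lemma pmfTail_pos_of_maximiser {B : ℕ} (hB : 1 ≤ B) {r : ℝ} (hr : r < 0) {η : ℝ} (hη : 0 < η)
    {j : ℕ} (hjB : j ≤ B) {f : ℕ → ℝ}
    (hmax : ∀ g : ℕ → ℝ, LatticePMF B g → RConcavePMF B r g → pmfMean B g ≤ η →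
      pmfTail B j g ≤ pmfTail B j f) :
    0 < pmfTail B j f := by
  have hB0 : (0 : ℝ) < B := by exact_mod_cast hB
  obtain ⟨δ, hδ, hδ1, hδη⟩ : ∃ δ : ℝ, 0 < δ ∧ δ ≤ 1 ∧ (B + 1) * δ ≤ η := by
    refine ⟨min 1 (η / (B + 1)), by positivity, min_le_left _ _, ?_⟩
    calc _ ≤ (B + 1) * (η / (B + 1)) := by gcongr; exact min_le_right _ _
      _ = η := by field_simp
  have hM : 1 ≤ δ ^ r := Real.one_le_rpow_of_pos_of_le_one_of_nonpos hδ hδ1 hr.le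
  set v : ℕ → ℝ := fun i => if i ≤ B then 1 else 0 with hv
  have hv1 : ∀ i ≤ B, v i = 1 := fun i hi => if_pos hi
  have hvB : ∀ i, B < i → v i = 0 := fun i hi => if_neg (by omega)
  have hvr : RConcavePMF B r v := by
    intro i m k him hmk hk _ _
    rw [hv1 i (by omega), hv1 m (by omega), hv1 k hk, Real.one_rpow]
    exact ⟨one_pos, by linarith⟩
  have hpos : ∀ i ≤ B, 0 < v i → 0 < v i ^ r + ((δ ^ r - 1) * i + 0) := by
    intro i hi _
    rw [hv1 i hi, Real.one_rpow]
    have : 0 ≤ (δ ^ r - 1) * (i : ℝ) := mul_nonneg (by linarith) i.cast_nonneg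
    linarith
  set u := affinePerturb r v (δ ^ r - 1) 0 with hu
  have hu0 : ∀ i, 0 ≤ u i := affinePerturb_nonneg hvB hpos
  have huB : ∀ i, B < i → u i = 0 := fun i hi =>
    affinePerturb_of_not_pos _ _ (by simp [hvB i hi])
  have hui : ∀ i ≤ B, u i = (1 + (δ ^ r - 1) * i) ^ r⁻¹ := fun i hi => by
    rw [hu, affinePerturb_of_pos _ _ (by simp [hv1 i hi]), hv1 i hi, Real.one_rpow, add_zero]
  have hupos : ∀ i ≤ B, 0 < u i := fun i hi => by
    rw [hui i hi]
    have : 0 ≤ (δ ^ r - 1) * (i : ℝ) := mul_nonneg (by linarith) i.cast_nonneg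
    exact Real.rpow_pos_of_pos (by linarith) _
  have hsum : 1 ≤ ∑ i ∈ range (B + 1), u i := by
    have h0 : u 0 = 1 := by simp [hui 0 (by omega)]
    rw [← h0]
    exact single_le_sum (fun i _ => hu0 i) (by simp)
  have hmean : pmfMean B u ≤ η := by
    calc pmfMean B u ≤ ∑ _i ∈ range (B + 1), δ := by
          refine sum_le_sum fun i hi => ?_
          have hi : i ≤ B := by simpa [Nat.lt_succ_iff] using hi
          rcases Nat.eq_zero_or_pos i with rfl | hi0
          · simpa using hδ.le
          have hi1 : (1 : ℝ) ≤ i := by exact_mod_cast hi0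
          have h1 : (i : ℝ) / B ≤ 1 := (div_le_one hB0).2 (by exact_mod_cast hi)
          have h2 : u i ≤ δ := by
            rw [hui i hi]
            calc _ ≤ (δ ^ r) ^ r⁻¹ := by
                  refine Real.rpow_le_rpow_of_nonpos (by linarith) ?_ (inv_nonpos.2 hr.le)
                  nlinarith
              _ = δ := Real.rpow_rpow_inv hδ.le hr.ne
          calc _ ≤ 1 * u i := mul_le_mul_of_nonneg_right h1 (hu0 i)
            _ ≤ δ := by linarith
      _ = (B + 1) * δ := by simp
      _ ≤ η := hδη
  have hs0 : 0 < ∑ i ∈ range (B + 1), u i := by linarith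
  have h := pmfTail_le_of_maximiser hmax hu0 huB hs0 (hvr.add_affine hr hpos)
    (by nlinarith)
  have htu : 0 < pmfTail B j u :=
    sum_pos (fun i hi => hupos i (mem_Icc.1 hi).2) ⟨j, by simp [hjB]⟩
  exact pos_of_mul_pos_left (htu.trans_le h) hs0.le

lemma div_mul_pmfTail_le_pmfMean {B j : ℕ} (hjB : j ≤ B) {f : ℕ → ℝ} (hf : ∀ i, 0 ≤ f i) :
    (j : ℝ) / B * pmfTail B j f ≤ pmfMean B f := by
  rw [pmfMean, ← sum_range_add_pmfTail hjB, pmfTail, pmfTail, mul_sum]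
  have h1 : 0 ≤ ∑ i ∈ range j, (i : ℝ) / B * f i :=
    sum_nonneg fun i _ => mul_nonneg (by positivity) (hf i)
  have h2 : ∑ i ∈ Icc j B, (j : ℝ) / B * f i ≤ ∑ i ∈ Icc j B, (i : ℝ) / B * f i := by
    refine sum_le_sum fun i hi => mul_le_mul_of_nonneg_right ?_ (hf i)
    have : (j : ℝ) ≤ i := by exact_mod_cast (mem_Icc.1 hi).1
    gcongr
  linarith

/-- Proposition 5(i) of Shah & Samworth (2013): any maximiser of the tail
probability over the mean-constrained `r`-concave class `F_{r,η}` attains the mean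
constraint with equality. -/
theorem rConcave_maximiser_mean_eq (B : ℕ) (hB : 1 ≤ B) (r : ℝ) (hr : r < 0)
    (η : ℝ) (hη : 0 < η) (j : ℕ) (hj1 : 1 ≤ j) (hjB : j ≤ B) (hηt : η < (j : ℝ) / B)
    (f : ℕ → ℝ) (hf : LatticePMF B f) (hfr : RConcavePMF B r f) (hfm : pmfMean B f ≤ η)
    (hmax : ∀ g : ℕ → ℝ, LatticePMF B g → RConcavePMF B r g → pmfMean B g ≤ η →
      pmfTail B j g ≤ pmfTail B j f) :
    pmfMean B f = η := by
  by_contra hne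
  have hlt : pmfMean B f < η := lt_of_le_of_ne hfm hne
  obtain ⟨hf0, hfB, hf1⟩ := hf
  have hT := pmfTail_pos_of_maximiser hB hr hη hjB hmax
  have hT1 : pmfTail B j f < 1 := by
    have := div_mul_pmfTail_le_pmfMean hjB hf0
    nlinarith
  have hsplit := sum_range_add_pmfTail hjB f
  rw [hf1] at hsplit
  -- The tilt by `-ε * (i - j + 1 / 2)` raises `f` on the tail and lowers it below the tail.
  set w : ℝ → ℕ → ℝ := fun ε => affinePerturb r f (-ε) (ε * (j - 1 / 2))
  have hw_pos : ∀ ε i, 0 < f i →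
      w ε i = (f i ^ r + (-ε * i + ε * (j - 1 / 2))) ^ r⁻¹ :=
    fun _ _ hi => affinePerturb_of_pos _ _ hi
  have hw_zero : ∀ ε i, ¬ 0 < f i → w ε i = f i := fun ε i hi =>
    (affinePerturb_of_not_pos _ _ hi).trans (le_antisymm (not_lt.1 hi) (hf0 i)).symm
  have hw0 : w 0 = f := by
    funext i
    by_cases hi : 0 < f i
    · rw [hw_pos _ _ hi]
      simp [Real.rpow_rpow_inv hi.le hr.ne]
    · exact hw_zero 0 i hi
  have hwc : ∀ i, ContinuousAt (fun ε => w ε i) 0 := by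
    intro i
    by_cases hi : 0 < f i
    · simp only [hw_pos _ _ hi]
      refine ContinuousAt.rpow_const (by fun_prop) (Or.inl ?_)
      simpa using (Real.rpow_pos_of_pos hi r).ne'
    · simp only [hw_zero _ _ hi]
      exact continuousAt_const
  have hbase : ∀ᶠ ε in 𝓝 (0 : ℝ),
      ∀ i ∈ range (B + 1), 0 < f i → 0 < f i ^ r + (-ε * i + ε * (j - 1 / 2)) := by
    rw [eventually_all_finset]
    intro i _
    by_cases hi : 0 < f i
    · have hc : ContinuousAt (fun ε : ℝ => f i ^ r + (-ε * i + ε * (j - 1 / 2))) 0 := by fun_prop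
      have := hc.eventually_const_lt (u := 0) (by simpa using Real.rpow_pos_of_pos hi r)
      filter_upwards [this] with ε hε _ using hε
    · exact Eventually.of_forall fun ε h => absurd h hi
  have hsumc : ContinuousAt (fun ε => ∑ i ∈ range (B + 1), w ε i) 0 :=
    tendsto_finsetSum _ fun i _ => hwc i
  have hmeanc : ContinuousAt (fun ε => pmfMean B (w ε)) 0 :=
    tendsto_finsetSum _ fun i _ => (hwc i).const_mul _
  have hsum : ∀ᶠ ε in 𝓝 (0 : ℝ), 0 < ∑ i ∈ range (B + 1), w ε i :=
    hsumc.eventually_const_lt (by simp [hw0, hf1])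
  have hmean : ∀ᶠ ε in 𝓝 (0 : ℝ), pmfMean B (w ε) < η * ∑ i ∈ range (B + 1), w ε i :=
    hmeanc.eventually_lt (hsumc.const_mul η) (by simpa [hw0, hf1] using hlt)
  obtain ⟨ε, ⟨hεb, hεs, hεm⟩, hε⟩ := (((hbase.and (hsum.and hmean)).filter_mono
    nhdsWithin_le_nhds).and (self_mem_nhdsWithin (s := Set.Ioi (0 : ℝ)))).exists
  have hε : 0 < ε := hε
  have hεb : ∀ i ≤ B, 0 < f i → 0 < f i ^ r + (-ε * i + ε * (j - 1 / 2)) := fun i hi =>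
    hεb i (by simpa [Nat.lt_succ_iff] using hi)
  have hmain := pmfTail_le_of_maximiser hmax (affinePerturb_nonneg hfB hεb)
    (fun i hi => affinePerturb_of_not_pos _ _ (by simp [hfB i hi])) hεs
    (hfr.add_affine hr hεb) hεm.le
  have hinv : r⁻¹ < 0 := inv_lt_zero.2 hr
  have htail_lt : ∀ i ∈ Icc j B, 0 < f i → f i < w ε i := by
    intro i hi hfi
    obtain ⟨hji, hiB⟩ := mem_Icc.1 hi
    have hji : (j : ℝ) ≤ i := by exact_mod_cast hji
    rw [hw_pos _ _ hfi]
    conv_lhs => rw [← Real.rpow_rpow_inv hfi.le hr.ne]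
    exact Real.rpow_lt_rpow_of_neg (hεb i hiB hfi) (by nlinarith) hinv
  have htail : pmfTail B j f < pmfTail B j (w ε) := by
    obtain ⟨i, hi, hfi⟩ := exists_lt_of_sum_lt (s := Icc j B) (f := fun _ => (0 : ℝ)) (g := f)
      (by simpa [pmfTail] using hT)
    refine sum_lt_sum (fun m hm => ?_) ⟨i, hi, htail_lt i hi hfi⟩
    by_cases hfm : 0 < f m
    · exact (htail_lt m hm hfm).le
    · exact (hw_zero ε m hfm).ge
  have hhead : ∑ i ∈ range j, w ε i ≤ ∑ i ∈ range j, f i := by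
    refine sum_le_sum fun i hi => ?_
    by_cases hfi : 0 < f i
    · have hij : (i : ℝ) + 1 ≤ j := by exact_mod_cast mem_range.1 hi
      rw [hw_pos _ _ hfi]
      conv_rhs => rw [← Real.rpow_rpow_inv hfi.le hr.ne]
      exact Real.rpow_le_rpow_of_nonpos (Real.rpow_pos_of_pos hfi r) (by nlinarith) hinv.le
    · exact (hw_zero ε i hfi).le
  have hmain : pmfTail B j (w ε) ≤ pmfTail B j f * ∑ i ∈ range (B + 1), w ε i := hmain
  rw [← sum_range_add_pmfTail hjB (w ε)] at hmain
  nlinarith [mul_le_mul_of_nonneg_left hhead hT.le, mul_lt_mul_of_pos_right htail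
    (sub_pos.2 hT1)]
end
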